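/- Let (W, S) be a finite (spherical) Coxeter system. An element x ∈ W is a parabolic quasi-Coxeter element if and only if there exists a quasi-Coxeter element w ∈ W with x ≤_T w in the absolute order. -/

import Mathlib

/-- The reflection length `ℓ_T w` of `w` in a Coxeter system: the least `k` such that
`w` is a product of `k` reflections. -/
noncomputable def reflLen {B W : Type*} [Group W] {M : CoxeterMatrix B}
    (cs : CoxeterSystem M W) (w : W) : ℕ :=
  sInf {k | ∃ l : List W, l.length = k ∧ (∀ t ∈ l, cs.IsReflection t) ∧ l.prod = w}

/-- `Red_T w`: the set of reduced reflection factorizations of `w`, i.e. tuples of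
reflections of length `ℓ_T w` with product `w`. -/
noncomputable def RedT {B W : Type*} [Group W] {M : CoxeterMatrix B}
    (cs : CoxeterSystem M W) (w : W) : Set (List W) :=
  {l | l.length = reflLen cs w ∧ (∀ t ∈ l, cs.IsReflection t) ∧ l.prod = w}

/-- The absolute order on `W`: `u ≤_T v` iff `ℓ_T(u) + ℓ_T(u⁻¹ v) = ℓ_T(v)`. -/
noncomputable def absLe {B W : Type*} [Group W] {M : CoxeterMatrix B}
    (cs : CoxeterSystem M W) (u v : W) : Prop :=
  reflLen cs u + reflLen cs (u⁻¹ * v) = reflLen cs v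

/-- A parabolic subgroup of a Coxeter system: a conjugate `u ⟨S'⟩ u⁻¹` of the subgroup
generated by a subset `S'` of the simple reflections. -/
def IsParabolic {B W : Type*} [Group W] {M : CoxeterMatrix B}
    (cs : CoxeterSystem M W) (P : Subgroup W) : Prop :=
  ∃ (u : W) (S' : Set B),
    P = (Subgroup.closure (cs.simple '' S')).map (MulAut.conj u).toMonoidHom

namespace CoxeterMatrix

variable {B : Type*} (M : CoxeterMatrix B)

/-- The canonical symmetric bilinear form of a Coxeter matrix, normalized so that each simple
root `Finsupp.single i 1` has square `2`. -/
noncomputable def cosForm : LinearMap.BilinForm ℝ (B →₀ ℝ) :=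
  Finsupp.linearCombination ℝ fun i ↦
    Finsupp.linearCombination ℝ fun j ↦ -2 * Real.cos (Real.pi / M i j)

/-- The reflection `x ↦ x - ⟨u, x⟩ u` of the geometric representation. -/
noncomputable def refl (u : B →₀ ℝ) : Module.End ℝ (B →₀ ℝ) :=
  LinearMap.id - (M.cosForm u).smulRight u

theorem cosForm_single (i j : B) :
    M.cosForm (.single i 1) (.single j 1) = -2 * Real.cos (Real.pi / M i j) := by
  simp [cosForm]

theorem cosForm_single_self (i : B) : M.cosForm (.single i 1) (.single i 1) = 2 := by
  simp [cosForm_single]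

theorem cosForm_comm (u v : B →₀ ℝ) : M.cosForm u v = M.cosForm v u := by
  have : M.cosForm = M.cosForm.flip := by
    refine Finsupp.lhom_ext' fun i ↦ LinearMap.ext_ring <| Finsupp.lhom_ext' fun j ↦
      LinearMap.ext_ring ?_
    simp [cosForm_single, M.symmetric i j]
  conv_lhs => rw [this]
  rfl

theorem isRefl_cosForm : M.cosForm.IsRefl := fun u v h ↦ by rwa [cosForm_comm]

theorem refl_apply (u x : B →₀ ℝ) : M.refl u x = x - M.cosForm u x • u := by
  simp [refl]

theorem refl_self {u : B →₀ ℝ} (hu : M.cosForm u u = 2) : M.refl u u = -u := by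
  rw [refl_apply, hu]; module

theorem refl_neg (u : B →₀ ℝ) : M.refl (-u) = M.refl u := by
  refine LinearMap.ext fun x ↦ ?_
  simp [refl_apply]

theorem cosForm_refl_refl {u : B →₀ ℝ} (hu : M.cosForm u u = 2) (x y : B →₀ ℝ) :
    M.cosForm (M.refl u x) (M.refl u y) = M.cosForm x y := by
  simp [refl_apply, hu, M.cosForm_comm x u]; ring

theorem refl_refl {u : B →₀ ℝ} (hu : M.cosForm u u = 2) (x : B →₀ ℝ) :
    M.refl u (M.refl u x) = x := by
  simp only [refl_apply, map_sub, map_smul, hu]; module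

theorem refl_mul_self {u : B →₀ ℝ} (hu : M.cosForm u u = 2) : M.refl u * M.refl u = 1 :=
  LinearMap.ext fun x ↦ M.refl_refl hu x

theorem two_le {i j : B} (hij : i ≠ j) (h0 : M i j ≠ 0) : 2 ≤ M i j := by
  have := M.off_diagonal i j hij
  have : M.M i j ≠ 0 := h0
  change 2 ≤ M.M i j
  omega

/-- The powers of a product of two simple reflections, on the plane they span. -/
theorem sin_smul_refl_mul_refl_pow {i j : B} (k : ℕ) :
    Real.sin (Real.pi / M i j) • ((M.refl (.single i 1) * M.refl (.single j 1)) ^ k)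
        (.single i 1) =
      Real.sin ((2 * k + 1) * (Real.pi / M i j)) • .single i 1 +
        Real.sin (2 * k * (Real.pi / M i j)) • .single j 1 ∧
    Real.sin (Real.pi / M i j) • ((M.refl (.single i 1) * M.refl (.single j 1)) ^ k)
        (.single j 1) =
      -Real.sin (2 * k * (Real.pi / M i j)) • .single i 1 -
        Real.sin ((2 * k - 1) * (Real.pi / M i j)) • .single j 1 := by
  set θ := Real.pi / M i j with hθ
  have hij : M.cosForm (.single i 1) (.single j 1) = -2 * Real.cos θ := M.cosForm_single i j
  have hji : M.cosForm (.single j 1) (.single i 1) = -2 * Real.cos θ := by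
    rw [cosForm_comm, hij]
  have hrec (x : ℝ) : Real.sin (x + θ) = 2 * Real.cos θ * Real.sin x - Real.sin (x - θ) := by
    rw [Real.sin_add, Real.sin_sub]; ring
  induction k with
  | zero => simp
  | succ k ih =>
    set P := M.refl (.single i 1) * M.refl (.single j 1)
    have hPi : P (.single i 1) = (4 * Real.cos θ ^ 2 - 1) • .single i 1 +
        (2 * Real.cos θ) • .single j 1 := by
      simp only [P, Module.End.mul_apply, refl_apply, hji, map_sub, map_smul, hij,
        cosForm_single_self]
      module
    have hPj : P (.single j 1) = -(2 * Real.cos θ) • .single i 1 - .single j 1 := by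
      simp only [P, Module.End.mul_apply, refl_apply, map_sub, map_smul, hij,
        cosForm_single_self]
      module
    have e1 : Real.sin ((2 * (k + 1 : ℕ) + 1) * θ) =
        (4 * Real.cos θ ^ 2 - 1) * Real.sin ((2 * k + 1) * θ) -
          2 * Real.cos θ * Real.sin (2 * k * θ) := by
      have h1 := hrec ((2 * k + 2) * θ)
      have h2 := hrec ((2 * k + 1) * θ)
      rw [show (2 * k + 2) * θ + θ = (2 * (k + 1 : ℕ) + 1) * θ by push_cast; ring,
        show (2 * k + 2) * θ - θ = (2 * k + 1) * θ by ring] at h1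
      rw [show (2 * k + 1) * θ + θ = (2 * k + 2) * θ by ring,
        show (2 * k + 1) * θ - θ = 2 * k * θ by ring] at h2
      rw [h1, h2]; ring
    have e2 : Real.sin (2 * (k + 1 : ℕ) * θ) =
        2 * Real.cos θ * Real.sin ((2 * k + 1) * θ) - Real.sin (2 * k * θ) := by
      have h2 := hrec ((2 * k + 1) * θ)
      rw [show (2 * k + 1) * θ + θ = 2 * (k + 1 : ℕ) * θ by push_cast; ring,
        show (2 * k + 1) * θ - θ = 2 * k * θ by ring] at h2
      exact h2
    have e3 : Real.sin ((2 * (k + 1 : ℕ) - 1) * θ) = Real.sin ((2 * k + 1) * θ) := by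
      push_cast; ring_nf
    have e4 : Real.sin ((2 * k - 1) * θ) =
        2 * Real.cos θ * Real.sin (2 * k * θ) - Real.sin ((2 * k + 1) * θ) := by
      have h2 := hrec (2 * k * θ)
      rw [show 2 * k * θ + θ = (2 * k + 1) * θ by ring,
        show 2 * k * θ - θ = (2 * k - 1) * θ by ring] at h2
      rw [h2]; ring
    simp only [pow_succ', Module.End.mul_apply]
    rw [← map_smul P, ← map_smul P, ih.1, ih.2, e1, e2, e3, e4]
    simp only [map_add, map_sub, map_smul, hPi, hPj]
    constructor <;> module

theorem refl_mul_refl_pow (i j : B) :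
    (M.refl (.single i 1) * M.refl (.single j 1)) ^ M i j = 1 := by
  rcases eq_or_ne i j with rfl | hij
  · rw [M.diagonal, pow_one]
    exact M.refl_mul_self (M.cosForm_single_self i)
  by_cases h0 : M i j = 0
  · rw [h0, pow_zero]
  have h2 : (2 : ℝ) ≤ M i j := by exact_mod_cast M.two_le hij h0
  have hm : (0 : ℝ) < M i j := by linarith
  set θ := Real.pi / M i j with hθ
  have hmθ : M i j * θ = Real.pi := by rw [hθ]; field_simp
  have hs : 0 < Real.sin θ := by
    refine Real.sin_pos_of_pos_of_lt_pi (by positivity) ?_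
    rw [hθ, div_lt_iff₀ hm]
    nlinarith [Real.pi_pos]
  have fix (z : B →₀ ℝ) (k : ℕ) (hz : M.cosForm (.single i 1) z = 0)
      (hz' : M.cosForm (.single j 1) z = 0) :
      ((M.refl (.single i 1) * M.refl (.single j 1)) ^ k) z = z := by
    induction k with
    | zero => rfl
    | succ k ih => simp [pow_succ, Module.End.mul_apply, refl_apply, hz, hz', ih]
  have s1 : Real.sin ((2 * M i j + 1) * θ) = Real.sin θ := by
    rw [add_mul, mul_assoc, hmθ, one_mul, add_comm, Real.sin_add_two_pi]
  have s2 : Real.sin (2 * M i j * θ) = 0 := by rw [mul_assoc, hmθ, Real.sin_two_pi]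
  have s3 : Real.sin ((2 * M i j - 1) * θ) = -Real.sin θ := by
    rw [sub_mul, mul_assoc, hmθ, one_mul, Real.sin_two_pi_sub]
  obtain ⟨hfi, hfj⟩ := M.sin_smul_refl_mul_refl_pow (i := i) (j := j) (M i j)
  simp only [← hθ, s1, s2, s3, zero_smul, add_zero, neg_zero, zero_sub, neg_smul, neg_neg]
    at hfi hfj
  replace hfi := smul_right_injective _ hs.ne' hfi
  replace hfj := smul_right_injective _ hs.ne' hfj
  have hij : M.cosForm (.single i 1) (.single j 1) = -2 * Real.cos θ := M.cosForm_single i j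
  have hji : M.cosForm (.single j 1) (.single i 1) = -2 * Real.cos θ := by
    rw [cosForm_comm, hij]
  refine LinearMap.ext fun x ↦ ?_
  set p := M.cosForm (.single i 1) x
  set q := M.cosForm (.single j 1) x
  set a := (p + Real.cos θ * q) / (2 * Real.sin θ ^ 2)
  set b := (q + Real.cos θ * p) / (2 * Real.sin θ ^ 2)
  have hsq : Real.sin θ ^ 2 = 1 - Real.cos θ ^ 2 := Real.sin_sq θ
  have hne : Real.sin θ ≠ 0 := hs.ne'
  have hz : x = (x - a • .single i 1 - b • .single j 1) + a • .single i 1 + b • .single j 1 := by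
    abel
  have hp : M.cosForm (.single i 1) (x - a • .single i 1 - b • .single j 1) = 0 := by
    simp only [map_sub, map_smul, hij, cosForm_single_self, smul_eq_mul]
    change p - a * 2 - b * _ = 0
    simp only [a, b]
    field_simp
    rw [hsq]; ring
  have hq : M.cosForm (.single j 1) (x - a • .single i 1 - b • .single j 1) = 0 := by
    simp only [map_sub, map_smul, hji, cosForm_single_self, smul_eq_mul]
    change q - a * _ - b * 2 = 0
    simp only [a, b]
    field_simp
    rw [hsq]; ring
  rw [hz, map_add, map_add, fix _ _ hp hq, map_smul, map_smul, hfi, hfj]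
  rfl

end CoxeterMatrix

namespace CoxeterSystem

variable {B W : Type*} [Group W] {M : CoxeterMatrix B} (cs : CoxeterSystem M W)

/-- The geometric representation of a Coxeter group. -/
noncomputable def geomRep : W →* Module.End ℝ (B →₀ ℝ) :=
  cs.lift ⟨fun i ↦ M.refl (.single i 1), fun i j ↦ M.refl_mul_refl_pow i j⟩

theorem geomRep_simple (i : B) : cs.geomRep (cs.simple i) = M.refl (.single i 1) :=
  cs.lift_apply_simple _ i

theorem geomRep_inv_apply (w : W) (x : B →₀ ℝ) : cs.geomRep w⁻¹ (cs.geomRep w x) = x := by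
  rw [← Module.End.mul_apply, ← map_mul]; simp

theorem geomRep_apply_inv (w : W) (x : B →₀ ℝ) : cs.geomRep w (cs.geomRep w⁻¹ x) = x := by
  rw [← Module.End.mul_apply, ← map_mul]; simp

theorem cosForm_geomRep (w : W) (x y : B →₀ ℝ) :
    M.cosForm (cs.geomRep w x) (cs.geomRep w y) = M.cosForm x y := by
  induction w using cs.simple_induction_left with
  | one => simp
  | mul_simple_left w i ih =>
    rw [map_mul, Module.End.mul_apply, Module.End.mul_apply, geomRep_simple,
      M.cosForm_refl_refl (M.cosForm_single_self i), ih]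

theorem cosForm_geomRep_left (w : W) (x y : B →₀ ℝ) :
    M.cosForm (cs.geomRep w x) y = M.cosForm x (cs.geomRep w⁻¹ y) := by
  rw [← cs.cosForm_geomRep w⁻¹, geomRep_inv_apply]

theorem geomRep_conj_refl (w : W) (u : B →₀ ℝ) :
    cs.geomRep w * M.refl u * cs.geomRep w⁻¹ = M.refl (cs.geomRep w u) := by
  refine LinearMap.ext fun x ↦ ?_
  simp only [Module.End.mul_apply, M.refl_apply, map_sub, map_smul, geomRep_apply_inv,
    cosForm_geomRep_left]

/-- The roots: the images of the simple roots under the group. -/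
def IsRoot (u : B →₀ ℝ) : Prop := ∃ w i, u = cs.geomRep w (.single i 1)

variable {cs}

theorem IsRoot.cosForm_self {u : B →₀ ℝ} (hu : cs.IsRoot u) : M.cosForm u u = 2 := by
  obtain ⟨w, i, rfl⟩ := hu
  rw [cosForm_geomRep, M.cosForm_single_self]

theorem IsRoot.geomRep {u : B →₀ ℝ} (hu : cs.IsRoot u) (w : W) :
    cs.IsRoot (cs.geomRep w u) := by
  obtain ⟨v, i, rfl⟩ := hu
  exact ⟨w * v, i, by simp⟩

theorem isRoot_single (i : B) : cs.IsRoot (.single i 1) := ⟨1, i, by simp⟩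

theorem IsRoot.exists_reflection {u : B →₀ ℝ} (hu : cs.IsRoot u) :
    ∃ t, cs.IsReflection t ∧ cs.geomRep t = M.refl u := by
  obtain ⟨w, i, rfl⟩ := hu
  exact ⟨w * cs.simple i * w⁻¹, ⟨w, i, rfl⟩, by
    rw [map_mul, map_mul, geomRep_simple, geomRep_conj_refl]⟩

theorem IsReflection.exists_root {t : W} (ht : cs.IsReflection t) :
    ∃ u, cs.IsRoot u ∧ cs.geomRep t = M.refl u := by
  obtain ⟨w, i, rfl⟩ := ht
  exact ⟨cs.geomRep w (.single i 1), ⟨w, i, rfl⟩, by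
    rw [map_mul, map_mul, geomRep_simple, geomRep_conj_refl]⟩

theorem IsRoot.refl {u v : B →₀ ℝ} (hu : cs.IsRoot u) (hv : cs.IsRoot v) :
    cs.IsRoot (M.refl u v) := by
  obtain ⟨t, -, ht⟩ := hu.exists_reflection
  exact ht ▸ hv.geomRep t

end CoxeterSystem

namespace CoxeterSystem

variable {B W : Type*} [Group W] {M : CoxeterMatrix B}

theorem matrix_ne_zero [Finite W] (cs : CoxeterSystem M W) (i j : B) : M i j ≠ 0 := by
  intro h0
  have hij : M.cosForm (.single i 1) (.single j 1) = -2 := by simp [M.cosForm_single, h0]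
  have hji : M.cosForm (.single j 1) (.single i 1) = -2 := by rw [M.cosForm_comm, hij]
  have key (k : ℕ) : cs.geomRep ((cs.simple i * cs.simple j) ^ k) (.single i 1) =
      .single i 1 + (2 * k : ℝ) • (.single i 1 + .single j 1) := by
    induction k with
    | zero => simp
    | succ k ih =>
      rw [pow_succ', map_mul, Module.End.mul_apply, ih, map_mul, Module.End.mul_apply]
      simp only [geomRep_simple, M.refl_apply, map_add, map_sub, map_smul, hij, hji,
        M.cosForm_single_self, smul_eq_mul]
      push_cast
      module
  have hne : i ≠ j := fun h ↦ by simp [h] at h0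
  have h := key (orderOf (cs.simple i * cs.simple j))
  rw [pow_orderOf_eq_one, map_one] at h
  have h := DFunLike.congr_fun h j
  have hpos : 0 < orderOf (cs.simple i * cs.simple j) := orderOf_pos _
  simp [hne, -orderOf_eq_zero_iff] at h
  omega

variable (cs : CoxeterSystem M W)

theorem sin_smul_geomRep_alternatingWord (i j : B) (k : ℕ) :
    Real.sin (Real.pi / M i j) • cs.geomRep (cs.wordProd (alternatingWord i j k)) (.single i 1) =
      Real.sin ((k + 1) * (Real.pi / M i j)) • .single (if Even k then i else j) 1 +
        Real.sin (k * (Real.pi / M i j)) • .single (if Even k then j else i) 1 := by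
  have hij : M.cosForm (.single i 1) (.single j 1) = -2 * Real.cos (Real.pi / M i j) :=
    M.cosForm_single i j
  have hji : M.cosForm (.single j 1) (.single i 1) = -2 * Real.cos (Real.pi / M i j) := by
    rw [M.cosForm_comm, hij]
  generalize Real.pi / M i j = θ at *
  have hrec (x : ℝ) : Real.sin (x + θ) = 2 * Real.cos θ * Real.sin x - Real.sin (x - θ) := by
    rw [Real.sin_add, Real.sin_sub]; ring
  induction k with
  | zero => simp [alternatingWord]
  | succ k ih =>
    have h1 := hrec ((k + 1) * θ)
    rw [show (k + 1) * θ - θ = k * θ by ring,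
      show (k + 1) * θ + θ = ((k + 1 : ℕ) + 1) * θ by push_cast; ring] at h1
    rw [alternatingWord_succ', cs.wordProd_cons, map_mul, Module.End.mul_apply,
      ← map_smul (cs.geomRep (cs.simple _)), ih, geomRep_simple, h1]
    push_cast
    by_cases hk : Even k
    · simp only [hk, Nat.even_add_one, if_true, not_true_eq_false, if_false]
      simp only [M.refl_apply, map_add, map_smul, hji, M.cosForm_single_self, smul_eq_mul]
      module
    · simp only [hk, Nat.even_add_one, if_true, not_false_eq_true, if_false]
      simp only [M.refl_apply, map_add, map_smul, hij, M.cosForm_single_self, smul_eq_mul]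
      module

variable [Finite W]

theorem geomRep_single_nonneg (w : W) (i : B) (h : ¬cs.IsRightDescent w i) :
    0 ≤ cs.geomRep w (.single i 1) := by
  induction hn : cs.length w using Nat.strong_induction_on generalizing w i with
  | _ n ih =>
  by_cases hw : w = 1
  · simp [hw]
  obtain ⟨j, hj⟩ := cs.exists_rightDescent_of_ne_one hw
  have hij : i ≠ j := fun e ↦ h (e ▸ hj)
  have h2 := M.two_le hij (cs.matrix_ne_zero i j)
  let v (k : ℕ) : W := w * (cs.wordProd (alternatingWord i j k))⁻¹
  have hwv (k) : w = v k * cs.wordProd (alternatingWord i j k) := by simp [v]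
  let Q (k : ℕ) : Prop := cs.length (v k) + k = cs.length w
  have hQ1 : Q 1 := by
    simpa [Q, v, alternatingWord] using cs.isRightDescent_iff.1 hj
  have hQm : ¬Q (M i j) := by
    intro hQ
    rw [not_isRightDescent_iff] at h
    obtain ⟨m, hm⟩ : ∃ m, M i j = m + 1 := ⟨M i j - 1, by omega⟩
    have hsub := cs.prod_alternatingWord_eq_prod_alternatingWord_sub i j (M i j) (by omega)
    rw [show M i j * 2 - M i j = m + 1 by omega, alternatingWord_succ, List.concat_eq_append,
      cs.wordProd_append] at hsub
    have hws : w * cs.simple i = v (M i j) * cs.wordProd (alternatingWord i j m) := by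
      conv_lhs => rw [hwv (M i j), hsub]
      simp [mul_assoc]
    have := cs.length_mul_le (v (M i j)) (cs.wordProd (alternatingWord i j m))
    have := cs.length_wordProd_le (alternatingWord i j m)
    simp only [length_alternatingWord] at this
    simp only [Q] at hQ
    rw [hws] at h
    omega
  obtain ⟨k, hk1, hkm, hQk, hQk'⟩ : ∃ k, 1 ≤ k ∧ k < M i j ∧ Q k ∧ ¬Q (k + 1) := by
    by_contra! hcon
    have hall (k : ℕ) (hk1 : 1 ≤ k) (hk : k ≤ M i j) : Q k := by
      induction k, hk1 using Nat.le_induction with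
      | base => exact hQ1
      | succ k hk1 ih => exact hcon k hk1 (by omega) (ih (by omega))
    exact hQm (hall _ (by omega) le_rfl)
  have hdesc (b : B) (hb : b = i ∨ b = j) : 0 ≤ cs.geomRep (v k) (.single b 1) := by
    refine ih (cs.length (v k)) (by simp only [Q] at hQk; omega) _ _ (fun hd ↦ ?_) rfl
    rw [isRightDescent_iff] at hd
    simp only [Q] at hQk hQk'
    obtain rfl | hbe : b = (if Even k then j else i) ∨ b = (if Even k then i else j) := by
      split_ifs <;> tauto
    · refine hQk' ?_
      have : v (k + 1) = v k * cs.simple (if Even k then j else i) := by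
        simp [v, alternatingWord_succ', cs.wordProd_cons, mul_assoc]
      rw [this]
      omega
    · obtain ⟨m, rfl⟩ : ∃ m, k = m + 1 := ⟨k - 1, by omega⟩
      have hbe' : b = if Even m then j else i := by
        rw [hbe]; by_cases hm : Even m <;> simp [hm, Nat.even_add_one]
      have : v m = v (m + 1) * cs.simple b := by
        simp [v, alternatingWord_succ', cs.wordProd_cons, mul_assoc, ← hbe']
      have h1 := cs.length_mul_le (v m) (cs.wordProd (alternatingWord i j m))
      have h2 := cs.length_wordProd_le (alternatingWord i j m)
      simp only [length_alternatingWord] at h2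
      rw [← hwv m, this] at h1
      omega
  have hvi := hdesc i (.inl rfl)
  have hvj := hdesc j (.inr rfl)
  have hm : (0 : ℝ) < M i j := by exact_mod_cast (by omega : 0 < M i j)
  have hsin (n : ℕ) (hn : n ≤ M i j) : 0 ≤ Real.sin (n * (Real.pi / M i j)) := by
    refine Real.sin_nonneg_of_nonneg_of_le_pi (by positivity) ?_
    rw [mul_div_assoc', div_le_iff₀ hm, mul_comm]
    gcongr
  have hs : 0 < Real.sin (Real.pi / M i j) := by
    refine Real.sin_pos_of_pos_of_lt_pi (by positivity) ?_
    rw [div_lt_iff₀ hm]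
    have : (2 : ℝ) ≤ M i j := by exact_mod_cast h2
    nlinarith [Real.pi_pos]
  have hmain : 0 ≤ Real.sin (Real.pi / M i j) • cs.geomRep w (.single i 1) := by
    conv_rhs => rw [hwv k]
    rw [map_mul, Module.End.mul_apply, ← map_smul, sin_smul_geomRep_alternatingWord, map_add,
      map_smul, map_smul]
    refine add_nonneg (smul_nonneg ?_ ?_) (smul_nonneg (hsin k hkm.le) ?_)
    · exact_mod_cast hsin (k + 1) hkm
    · split_ifs <;> assumption
    · split_ifs <;> assumption
  intro b
  have := hmain b
  simp only [Finsupp.coe_smul, Pi.smul_apply, smul_eq_mul, Finsupp.coe_zero, Pi.zero_apply] at this ⊢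
  exact nonneg_of_mul_nonneg_right this hs

end CoxeterSystem

namespace CoxeterSystem

variable {B W : Type*} [Group W] {M : CoxeterMatrix B} (cs : CoxeterSystem M W)

theorem geomRep_mul_simple_single (w : W) (i : B) :
    cs.geomRep (w * cs.simple i) (.single i 1) = -cs.geomRep w (.single i 1) := by
  rw [map_mul, Module.End.mul_apply, geomRep_simple, M.refl_self (M.cosForm_single_self i),
    map_neg]

theorem simple_injective : Function.Injective cs.simple := by
  classical
  intro i j h
  by_contra hij
  have h := congrArg (fun g ↦ cs.geomRep g (.single i 1) i) h
  simp [geomRep_simple, M.refl_apply, M.cosForm_single_self, hij] at h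

variable [Finite W]

include cs

theorem finite_index : Finite B := Finite.of_injective _ cs.simple_injective

theorem geomRep_single_nonpos (w : W) (i : B) (h : cs.IsRightDescent w i) :
    cs.geomRep w (.single i 1) ≤ 0 := by
  have := cs.geomRep_single_nonneg (w * cs.simple i) i
    (cs.isRightDescent_iff_not_isRightDescent_mul.1 h)
  rw [geomRep_mul_simple_single] at this
  exact neg_nonneg.1 this

theorem geomRep_injective : Function.Injective cs.geomRep := by
  refine (injective_iff_map_eq_one _).2 fun w hw ↦ by_contra fun hne ↦ ?_
  obtain ⟨i, hi⟩ := cs.exists_rightDescent_of_ne_one hne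
  have := cs.geomRep_single_nonpos w i hi i
  simp [hw] at this
  norm_num at this

/-- The canonical form of a finite Coxeter group is positive definite. -/
theorem cosForm_self_pos {v : B →₀ ℝ} (hv : v ≠ 0) : 0 < M.cosForm v v := by
  classical
  have := cs.finite_index
  have := Fintype.ofFinite B
  have := Fintype.ofFinite W
  let D : LinearMap.BilinForm ℝ (B →₀ ℝ) := Finsupp.linearCombination ℝ fun i ↦ Finsupp.lapply i
  have hD (x y : B →₀ ℝ) : D x y = ∑ i, x i * y i := by
    simp [D, Finsupp.linearCombination_apply, Finsupp.sum_fintype]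
  have hDnn (x : B →₀ ℝ) : 0 ≤ D x x := by
    rw [hD]; exact Finset.sum_nonneg fun i _ ↦ mul_self_nonneg _
  let A : LinearMap.BilinForm ℝ (B →₀ ℝ) := ∑ w : W, D.comp (cs.geomRep w) (cs.geomRep w)
  have hA (x y : B →₀ ℝ) : A x y = ∑ w : W, D (cs.geomRep w x) (cs.geomRep w y) := by
    simp [A, LinearMap.sum_apply]
  have hApos (x : B →₀ ℝ) (hx : x ≠ 0) : 0 < A x x := by
    rw [hA]
    refine Finset.sum_pos' (fun w _ ↦ hDnn _) ⟨1, Finset.mem_univ _, ?_⟩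
    obtain ⟨i, hi⟩ := Finsupp.ne_iff.1 hx
    simp only [map_one, Module.End.one_apply, hD]
    exact Finset.sum_pos' (fun j _ ↦ mul_self_nonneg _)
      ⟨i, Finset.mem_univ _, mul_self_pos.2 (by simpa using hi)⟩
  have hAinv (g : W) (x y : B →₀ ℝ) : A (cs.geomRep g x) (cs.geomRep g y) = A x y := by
    rw [hA, hA]
    exact Fintype.sum_equiv (Equiv.mulRight g) _ _ fun w ↦ by simp
  have hAcomm (x y : B →₀ ℝ) : A x y = A y x := by
    simp only [hA, hD]
    exact Finset.sum_congr rfl fun w _ ↦ Finset.sum_congr rfl fun i _ ↦ mul_comm _ _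
  let a (i : B) : ℝ := A (.single i 1) (.single i 1) / 2
  have ha (i : B) : 0 < a i := half_pos (hApos _ (by simp))
  have hAG (i : B) (x : B →₀ ℝ) : A x (.single i 1) = a i * M.cosForm (.single i 1) x := by
    have h1 := hAinv (cs.simple i) x (.single i 1)
    rw [geomRep_simple, M.refl_self (M.cosForm_single_self i), M.refl_apply] at h1
    simp only [map_neg, map_sub, map_smul, LinearMap.sub_apply, LinearMap.smul_apply,
      smul_eq_mul] at h1
    simp only [a]
    linarith
  have hsymm (i j : B) : a i * M.cosForm (.single i 1) (.single j 1) =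
      a j * M.cosForm (.single i 1) (.single j 1) := by
    rw [← hAG, M.cosForm_comm, ← hAG, hAcomm]
  have hscale (i j : B) : (√(a i))⁻¹ * (√(a j))⁻¹ * A (.single j 1) (.single i 1) =
      M.cosForm (.single j 1) (.single i 1) := by
    rw [hAG, M.cosForm_comm (.single j 1)]
    by_cases h0 : M.cosForm (.single i 1) (.single j 1) = 0
    · simp [h0]
    rw [← mul_right_cancel₀ h0 (hsymm i j), ← mul_assoc, ← mul_inv, Real.mul_self_sqrt (ha i).le,
      inv_mul_cancel₀ (ha i).ne', one_mul]
  have hexp (x : B →₀ ℝ) : x = ∑ i, x i • .single i 1 := by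
    conv_lhs => rw [← Finsupp.univ_sum_single x]
    simp
  let v' : B →₀ ℝ := ∑ i, (v i * (√(a i))⁻¹) • .single i 1
  have hv' : v' ≠ 0 := by
    obtain ⟨i, hi⟩ := Finsupp.ne_iff.1 hv
    refine fun h ↦ mul_ne_zero hi (inv_ne_zero (Real.sqrt_pos.2 (ha i)).ne') ?_
    have := DFunLike.congr_fun h i
    simpa [v', Finsupp.finsetSum_apply, Finsupp.single_apply] using this
  have hfin : M.cosForm v v = A v' v' := by
    conv_lhs => rw [hexp v]
    simp only [v', map_sum, map_smul, LinearMap.sum_apply, LinearMap.smul_apply, smul_eq_mul]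
    refine Finset.sum_congr rfl fun i _ ↦ ?_
    rw [mul_assoc, Finset.mul_sum (a := (√(a i))⁻¹)]
    congr 1
    refine Finset.sum_congr rfl fun j _ ↦ ?_
    rw [← hscale]
    ring
  exact hfin ▸ hApos v' hv'

theorem eq_zero_of_cosForm_self {v : B →₀ ℝ} (hv : M.cosForm v v = 0) : v = 0 :=
  by_contra fun h ↦ (cs.cosForm_self_pos h).ne' hv

theorem eq_of_cosForm_eq_two {u v : B →₀ ℝ} (hu : M.cosForm u u = 2) (hv : M.cosForm v v = 2)
    (h : M.cosForm u v = 2) : u = v := by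
  refine sub_eq_zero.1 (cs.eq_zero_of_cosForm_self ?_)
  simp only [map_sub, LinearMap.sub_apply, hu, hv, h, M.cosForm_comm v u]
  norm_num

theorem cosForm_nondegenerate : M.cosForm.Nondegenerate :=
  ⟨fun _ hv ↦ cs.eq_zero_of_cosForm_self (hv _), fun _ hv ↦ cs.eq_zero_of_cosForm_self (hv _)⟩

end CoxeterSystem

namespace CoxeterSystem

variable {B W : Type*} [Group W] {M : CoxeterMatrix B} (cs : CoxeterSystem M W) [Finite W]

theorem cosForm_nonpos_of_dominant {v x : B →₀ ℝ} (hv : ∀ i, 0 ≤ M.cosForm v (.single i 1))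
    (hx : x ≤ 0) : M.cosForm v x ≤ 0 := by
  rw [← Finsupp.sum_single x, map_finsuppSum]
  refine Finset.sum_nonpos fun i _ ↦ ?_
  beta_reduce
  rw [show Finsupp.single i (x i) = x i • Finsupp.single i 1 by simp, map_smul, smul_eq_mul]
  exact mul_nonpos_of_nonpos_of_nonneg (hx i) (hv i)

/-- Every vector can be moved into the closed fundamental chamber. -/
theorem exists_geomRep_dominant (v : B →₀ ℝ) :
    ∃ g, ∀ i, 0 ≤ M.cosForm (cs.geomRep g v) (.single i 1) := by
  have := cs.finite_index
  have := Fintype.ofFinite B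
  obtain ⟨g, hg⟩ := Finite.exists_max fun g : W ↦ ∑ i, cs.geomRep g v i
  refine ⟨g, fun i ↦ ?_⟩
  have h := hg (cs.simple i * g)
  simp only [map_mul, Module.End.mul_apply, geomRep_simple, M.refl_apply, Finsupp.coe_sub,
    Pi.sub_apply, Finset.sum_sub_distrib, Finsupp.coe_smul, Pi.smul_apply, smul_eq_mul,
    ← Finset.mul_sum, Finsupp.univ_sum_single_apply] at h
  rw [M.cosForm_comm]
  linarith

/-- The stabilizer of a vector in the closed fundamental chamber is generated by simple
reflections. -/
theorem mem_closure_of_geomRep_eq {v : B →₀ ℝ} (hv : ∀ i, 0 ≤ M.cosForm v (.single i 1)) {w : W}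
    (hw : cs.geomRep w v = v) :
    w ∈ Subgroup.closure (cs.simple '' {j | M.cosForm v (.single j 1) = 0}) := by
  induction hn : cs.length w using Nat.strong_induction_on generalizing w with
  | _ n ih =>
  by_cases h1 : w = 1
  · exact h1 ▸ one_mem _
  obtain ⟨i, hi⟩ := cs.exists_rightDescent_of_ne_one h1
  have h0 : M.cosForm v (.single i 1) = 0 := by
    refine le_antisymm ?_ (hv i)
    rw [← cs.cosForm_geomRep w, hw]
    exact cosForm_nonpos_of_dominant hv (cs.geomRep_single_nonpos w i hi)
  have hmem : cs.simple i ∈ Subgroup.closure (cs.simple '' {j | M.cosForm v (.single j 1) = 0}) :=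
    Subgroup.subset_closure ⟨i, h0, rfl⟩
  rw [← cs.simple_mul_simple_cancel_right (w := w) i]
  refine mul_mem (ih _ (hn ▸ hi) ?_ rfl) hmem
  rw [map_mul, Module.End.mul_apply, geomRep_simple, M.refl_apply, M.cosForm_comm, h0, zero_smul,
    sub_zero, hw]

theorem finite_isRoot : {u | cs.IsRoot u}.Finite := by
  have := cs.finite_index
  refine (Set.finite_range fun p : W × B ↦ cs.geomRep p.1 (.single p.2 1)).subset ?_
  rintro _ ⟨w, i, rfl⟩
  exact ⟨(w, i), rfl⟩

/-- The pointwise stabilizer of a subspace is contained in a parabolic subgroup all of whose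
roots are orthogonal to the subspace. -/
theorem exists_parabolic_of_submodule (U : Submodule ℝ (B →₀ ℝ)) :
    ∃ (g : W) (J : Set B),
      (∀ j ∈ J, ∀ x ∈ U, M.cosForm (cs.geomRep g (.single j 1)) x = 0) ∧
      ∀ w, (∀ x ∈ U, cs.geomRep w x = x) →
        g⁻¹ * w * g ∈ Subgroup.closure (cs.simple '' J) := by
  have hfin : {u | cs.IsRoot u ∧ ∃ x ∈ U, M.cosForm u x ≠ 0}.Finite :=
    cs.finite_isRoot.subset fun u hu ↦ hu.1
  have := hfin.to_subtype
  obtain ⟨v, hvU, hv⟩ := Module.Dual.exists_forall_mem_ne_zero_of_forall_exists U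
    (fun u : {u | cs.IsRoot u ∧ ∃ x ∈ U, M.cosForm u x ≠ 0} ↦ M.cosForm u) (fun u ↦ u.2.2)
  obtain ⟨g, hg⟩ := cs.exists_geomRep_dominant v
  refine ⟨g⁻¹, {j | M.cosForm (cs.geomRep g v) (.single j 1) = 0}, fun j hj x hx ↦ ?_,
    fun w hw ↦ cs.mem_closure_of_geomRep_eq hg ?_⟩
  · by_contra hne
    refine hv ⟨_, (isRoot_single j).geomRep g⁻¹, x, hx, hne⟩ ?_
    change M.cosForm (cs.geomRep g v) (.single j 1) = 0 at hj
    change M.cosForm (cs.geomRep g⁻¹ (.single j 1)) v = 0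
    rw [cosForm_geomRep_left, inv_inv, M.cosForm_comm, hj]
  · simp only [inv_inv, map_mul, Module.End.mul_apply, geomRep_inv_apply, hw v hvU]

end CoxeterSystem

section ListSpan

variable {V : Type*} [AddCommGroup V] [Module ℝ V]

/-- The span of the entries of a list. -/
def listSpan (l : List V) : Submodule ℝ V := Submodule.span ℝ {b | b ∈ l}

/-- A list of vectors is independent if its span has the largest possible dimension. -/
def ListIndep (l : List V) : Prop := Module.finrank ℝ (listSpan l) = l.length

theorem mem_listSpan {l : List V} {b : V} (hb : b ∈ l) : b ∈ listSpan l :=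
  Submodule.subset_span hb

theorem listSpan_le {l : List V} {p : Submodule ℝ V} : listSpan l ≤ p ↔ ∀ b ∈ l, b ∈ p :=
  Submodule.span_le

theorem listSpan_append (l₁ l₂ : List V) :
    listSpan (l₁ ++ l₂) = listSpan l₁ ⊔ listSpan l₂ := by
  rw [listSpan, listSpan, listSpan, ← Submodule.span_union]
  congr 1
  ext; simp

theorem listSpan_nil : listSpan ([] : List V) = ⊥ := by simp [listSpan]

theorem listSpan_cons (b : V) (l : List V) :
    listSpan (b :: l) = Submodule.span ℝ {b} ⊔ listSpan l := by
  rw [← List.singleton_append, listSpan_append]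
  simp [listSpan]

instance finiteDimensional_listSpan (l : List V) : FiniteDimensional ℝ (listSpan l) :=
  FiniteDimensional.span_of_finite ℝ l.finite_toSet

theorem finrank_listSpan_le (l : List V) : Module.finrank ℝ (listSpan l) ≤ l.length := by
  classical
  have := finrank_span_finset_le_card (R := ℝ) l.toFinset
  rw [List.coe_toFinset] at this
  exact this.trans l.toFinset_card_le

theorem listIndep_append {l₁ l₂ : List V} :
    ListIndep (l₁ ++ l₂) ↔
      ListIndep l₁ ∧ ListIndep l₂ ∧ Disjoint (listSpan l₁) (listSpan l₂) := by
  have h := Submodule.finrank_sup_add_finrank_inf_eq (listSpan l₁) (listSpan l₂)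
  rw [← listSpan_append] at h
  have h1 := finrank_listSpan_le l₁
  have h2 := finrank_listSpan_le l₂
  have h3 := finrank_listSpan_le (l₁ ++ l₂)
  have : FiniteDimensional ℝ ↥(listSpan l₁ ⊓ listSpan l₂) :=
    Submodule.finiteDimensional_inf_left _ _
  rw [disjoint_iff, ← Submodule.finrank_eq_zero (R := ℝ)]
  simp only [ListIndep, List.length_append] at *
  omega

theorem listIndep_cons {b : V} {l : List V} :
    ListIndep (b :: l) ↔ b ∉ listSpan l ∧ ListIndep l := by
  rw [← List.singleton_append, listIndep_append]
  have hb : listSpan [b] = Submodule.span ℝ {b} := by simp [listSpan]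
  have hb' : ListIndep [b] ↔ Module.finrank ℝ (Submodule.span ℝ {b}) = 1 := by
    rw [ListIndep, hb, List.length_singleton]
  rw [hb', hb]
  by_cases h0 : b = 0
  · subst h0
    rw [Submodule.span_zero_singleton, finrank_bot]
    simp
  · rw [disjoint_comm, Submodule.disjoint_span_singleton' h0]
    simp [finrank_span_singleton h0, and_comm]

theorem mem_ker_one_sub {f : Module.End ℝ V} {x : V} : x ∈ LinearMap.ker (1 - f) ↔ f x = x := by
  rw [LinearMap.mem_ker, LinearMap.sub_apply, Module.End.one_apply, sub_eq_zero, eq_comm]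

end ListSpan

namespace CoxeterMatrix

variable {B : Type*} (M : CoxeterMatrix B)

/-- The product of the reflections in a list of vectors. -/
noncomputable def reflProd (l : List (B →₀ ℝ)) : Module.End ℝ (B →₀ ℝ) := (l.map M.refl).prod

theorem reflProd_nil : M.reflProd [] = 1 := rfl

theorem reflProd_cons (b : B →₀ ℝ) (l : List (B →₀ ℝ)) :
    M.reflProd (b :: l) = M.refl b * M.reflProd l := by simp [reflProd]

theorem sub_reflProd_mem (l : List (B →₀ ℝ)) (v : B →₀ ℝ) :
    v - M.reflProd l v ∈ listSpan l := by
  induction l with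
  | nil => simp [reflProd_nil]
  | cons b l ih =>
    rw [reflProd_cons, Module.End.mul_apply, refl_apply, listSpan_cons]
    have : v - (M.reflProd l v - M.cosForm b (M.reflProd l v) • b) =
        M.cosForm b (M.reflProd l v) • b + (v - M.reflProd l v) := by abel
    rw [this]
    exact Submodule.add_mem_sup
      (Submodule.smul_mem _ _ (Submodule.mem_span_singleton_self b)) ih

theorem reflProd_apply_of_orthogonal {l : List (B →₀ ℝ)} {v : B →₀ ℝ}
    (h : ∀ b ∈ l, M.cosForm b v = 0) : M.reflProd l v = v := by
  induction l with
  | nil => simp [reflProd_nil]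
  | cons b l ih =>
    rw [reflProd_cons, Module.End.mul_apply, ih fun c hc ↦ h c (by simp [hc]), refl_apply,
      h b (by simp), zero_smul, sub_zero]

theorem orthogonal_of_reflProd_apply {l : List (B →₀ ℝ)} (hl : ListIndep l) {v : B →₀ ℝ}
    (hv : M.reflProd l v = v) : ∀ b ∈ l, M.cosForm b v = 0 := by
  induction l with
  | nil => simp
  | cons b l ih =>
    obtain ⟨hb, hl⟩ := listIndep_cons.1 hl
    rw [reflProd_cons, Module.End.mul_apply, refl_apply] at hv
    have h0 : M.cosForm b (M.reflProd l v) = 0 := by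
      by_contra hne
      refine hb ((Submodule.smul_mem_iff _ hne).1 ?_)
      have := neg_mem (M.sub_reflProd_mem l v)
      rwa [neg_sub, show M.reflProd l v - v = M.cosForm b (M.reflProd l v) • b by
        rw [sub_eq_iff_eq_add, ← sub_eq_iff_eq_add']; exact hv] at this
    rw [h0, zero_smul, sub_zero] at hv
    rw [hv] at h0
    simpa [h0] using ih hl hv

theorem cosForm_eq_zero_of_mem_listSpan {l : List (B →₀ ℝ)} {v : B →₀ ℝ}
    (h : ∀ b ∈ l, M.cosForm b v = 0) {u : B →₀ ℝ} (hu : u ∈ listSpan l) : M.cosForm u v = 0 := by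
  have : listSpan l ≤ LinearMap.ker (M.cosForm.flip v) := listSpan_le.2 fun b hb ↦ by
    simpa using h b hb
  simpa using this hu

theorem ker_one_sub_reflProd {l : List (B →₀ ℝ)} (hl : ListIndep l) :
    LinearMap.ker (1 - M.reflProd l) = M.cosForm.orthogonal (listSpan l) := by
  ext v
  rw [mem_ker_one_sub, LinearMap.BilinForm.mem_orthogonal_iff]
  exact ⟨fun h u hu ↦ M.cosForm_eq_zero_of_mem_listSpan (M.orthogonal_of_reflProd_apply hl h) hu,
    fun h ↦ M.reflProd_apply_of_orthogonal fun b hb ↦ h b (mem_listSpan hb)⟩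

end CoxeterMatrix

namespace CoxeterSystem

variable {B W : Type*} [Group W] {M : CoxeterMatrix B} (cs : CoxeterSystem M W) [Finite W]

include cs in
theorem range_one_sub_reflProd {l : List (B →₀ ℝ)} (hl : ListIndep l) :
    LinearMap.range (1 - M.reflProd l) = listSpan l := by
  have := cs.finite_index
  refine Submodule.eq_of_le_of_finrank_eq ?_ ?_
  · rintro _ ⟨v, rfl⟩
    exact M.sub_reflProd_mem l v
  · have h1 := LinearMap.finrank_range_add_finrank_ker (1 - M.reflProd l)
    have h2 := LinearMap.BilinForm.finrank_orthogonal cs.cosForm_nondegenerate (listSpan l)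
    have h3 := Submodule.finrank_le (listSpan l)
    rw [M.ker_one_sub_reflProd hl] at h1
    omega

theorem range_one_sub_geomRep (w : W) :
    LinearMap.range (1 - cs.geomRep w) =
      M.cosForm.orthogonal (LinearMap.ker (1 - cs.geomRep w)) := by
  have := cs.finite_index
  refine Submodule.eq_of_le_of_finrank_eq ?_ ?_
  · rintro _ ⟨v, rfl⟩ u hu
    have hu : u = cs.geomRep w u := (mem_ker_one_sub.1 hu).symm
    change M.cosForm u ((1 - cs.geomRep w) v) = 0
    rw [LinearMap.sub_apply, map_sub, Module.End.one_apply]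
    conv_lhs => rw [← cs.cosForm_geomRep w u v, ← hu]
    simp
  · have h1 := LinearMap.finrank_range_add_finrank_ker (1 - cs.geomRep w)
    have h2 := LinearMap.BilinForm.finrank_orthogonal cs.cosForm_nondegenerate
      (LinearMap.ker (1 - cs.geomRep w))
    omega

/-- Carter's lemma: every element is a product of reflections in independent roots. -/
theorem exists_listIndep_reflProd (w : W) :
    ∃ l : List (B →₀ ℝ), (∀ b ∈ l, cs.IsRoot b) ∧ ListIndep l ∧ cs.geomRep w = M.reflProd l := by
  have := cs.finite_index
  induction hn : Module.finrank ℝ (LinearMap.range (1 - cs.geomRep w))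
    using Nat.strong_induction_on generalizing w with
  | _ n ih =>
  by_cases h1 : w = 1
  · exact ⟨[], by simp, by simp [ListIndep, listSpan_nil], by simp [h1, CoxeterMatrix.reflProd_nil]⟩
  obtain ⟨g, J, hJ, hmem⟩ := cs.exists_parabolic_of_submodule (LinearMap.ker (1 - cs.geomRep w))
  obtain ⟨j, hj⟩ : J.Nonempty := by
    by_contra hJ0
    rw [Set.not_nonempty_iff_eq_empty] at hJ0
    have := hmem w fun x hx ↦ mem_ker_one_sub.1 hx
    rw [hJ0, Set.image_empty, Subgroup.closure_empty, Subgroup.mem_bot] at this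
    exact h1 (by simpa [mul_assoc, inv_mul_eq_one, eq_comm] using this)
  set α := cs.geomRep g (.single j 1) with hα
  have hroot : cs.IsRoot α := ⟨g, j, rfl⟩
  obtain ⟨t, -, ht⟩ := hroot.exists_reflection
  have hαα := hroot.cosForm_self
  obtain ⟨v, hv⟩ : α ∈ LinearMap.range (1 - cs.geomRep w) := by
    rw [range_one_sub_geomRep]
    intro u hu
    change M.cosForm u α = 0
    rw [M.cosForm_comm, hJ j hj u hu]
  have hwv : cs.geomRep w v = v - α := by rw [← hv]; simp
  have hvα : M.cosForm α v = 1 := by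
    have := cs.cosForm_geomRep w v v
    simp only [hwv, map_sub, LinearMap.sub_apply, hαα, M.cosForm_comm v α] at this
    linarith
  have hfix : cs.geomRep (t * w) v = v := by
    rw [map_mul, Module.End.mul_apply, hwv, ht, M.refl_apply, map_sub, hvα, hαα]
    module
  have hlt : LinearMap.ker (1 - cs.geomRep w) < LinearMap.ker (1 - cs.geomRep (t * w)) := by
    refine SetLike.lt_iff_le_and_exists.2 ⟨fun u hu ↦ ?_, v, mem_ker_one_sub.2 hfix, fun hvU ↦ ?_⟩
    · have hu' : cs.geomRep w u = u := mem_ker_one_sub.1 hu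
      rw [mem_ker_one_sub, map_mul, Module.End.mul_apply, hu', ht, M.refl_apply, hJ j hj u hu,
        zero_smul, sub_zero]
    · rw [LinearMap.mem_ker, hv] at hvU
      simp [hvU] at hαα
  have hrk := LinearMap.finrank_range_add_finrank_ker (1 - cs.geomRep w)
  have hrk' := LinearMap.finrank_range_add_finrank_ker (1 - cs.geomRep (t * w))
  have := Submodule.finrank_lt_finrank_of_lt hlt
  obtain ⟨l, hl, hli, hw⟩ := ih _ (by omega) (t * w) rfl
  refine ⟨α :: l, by simpa [hroot] using hl, listIndep_cons.2 ⟨fun hmem ↦ ?_, hli⟩, ?_⟩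
  · rw [hw] at hfix
    have := M.cosForm_eq_zero_of_mem_listSpan (M.orthogonal_of_reflProd_apply hli hfix) hmem
    rw [hvα] at this
    exact one_ne_zero this
  · rw [M.reflProd_cons, ← hw, map_mul, ht, ← mul_assoc, M.refl_mul_self hαα, one_mul]

end CoxeterSystem

namespace CoxeterMatrix

variable {B : Type*} (M : CoxeterMatrix B)

theorem eq_or_eq_neg_of_refl_eq {u v : B →₀ ℝ} (hu : M.cosForm u u = 2) (hv : M.cosForm v v = 2)
    (h : M.refl u = M.refl v) : u = v ∨ u = -v := by
  have h1 := LinearMap.congr_fun h u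
  rw [M.refl_self hu, M.refl_apply] at h1
  have h2 : u = (M.cosForm v u / 2) • v := by
    have : (2 : ℝ) • u = M.cosForm v u • v := by
      rw [two_smul]
      calc u + u = u - -u := by abel
        _ = _ := by rw [h1]; abel
    rw [div_eq_inv_mul, mul_smul, ← this, smul_smul]
    norm_num
  have h3 : (M.cosForm v u / 2) ^ 2 = 1 := by
    have := hu
    rw [h2] at this
    simp only [map_smul, LinearMap.smul_apply, smul_eq_mul, hv] at this
    linarith
  rcases eq_or_eq_neg_of_sq_eq_sq _ 1 (h3.trans (one_pow 2).symm) with h4 | h4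
  · left; rw [h2, h4, one_smul]
  · right; rw [h2, h4, neg_one_smul]

end CoxeterMatrix

namespace CoxeterSystem

variable {B W : Type*} [Group W] {M : CoxeterMatrix B} (cs : CoxeterSystem M W)

open Classical in
/-- A choice of root for each reflection. -/
noncomputable def rootOf (t : W) : B →₀ ℝ :=
  if h : ∃ u, cs.IsRoot u ∧ cs.geomRep t = M.refl u then h.choose else 0

theorem IsReflection.isRoot_rootOf {t : W} (ht : cs.IsReflection t) : cs.IsRoot (cs.rootOf t) := by
  rw [rootOf, dif_pos ht.exists_root]
  exact ht.exists_root.choose_spec.1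

theorem IsReflection.geomRep_eq {t : W} (ht : cs.IsReflection t) :
    cs.geomRep t = M.refl (cs.rootOf t) := by
  rw [rootOf, dif_pos ht.exists_root]
  exact ht.exists_root.choose_spec.2

theorem geomRep_list_prod {l : List W} (hl : ∀ t ∈ l, cs.IsReflection t) :
    cs.geomRep l.prod = M.reflProd (l.map cs.rootOf) := by
  induction l with
  | nil => simp [CoxeterMatrix.reflProd_nil]
  | cons t l ih =>
    rw [List.prod_cons, map_mul, ih fun s hs ↦ hl s (by simp [hs]), List.map_cons,
      M.reflProd_cons, (hl t (by simp)).geomRep_eq]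

theorem isRoot_of_mem_map_rootOf {l : List W} (hl : ∀ t ∈ l, cs.IsReflection t) {b : B →₀ ℝ}
    (hb : b ∈ l.map cs.rootOf) : cs.IsRoot b := by
  obtain ⟨t, ht, rfl⟩ := List.mem_map.1 hb
  exact (hl t ht).isRoot_rootOf

theorem sub_geomRep_mem_of_mem_closure {T : Set W} {L : Submodule ℝ (B →₀ ℝ)}
    (hT : ∀ t ∈ T, ∀ v, v - cs.geomRep t v ∈ L) {g : W} (hg : g ∈ Subgroup.closure T)
    (v : B →₀ ℝ) : v - cs.geomRep g v ∈ L := by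
  induction hg using Subgroup.closure_induction generalizing v with
  | mem t ht => exact hT t ht v
  | one => simp
  | mul a b _ _ iha ihb =>
    rw [map_mul, Module.End.mul_apply, ← sub_add_sub_cancel v (cs.geomRep b v)]
    exact add_mem (ihb v) (iha _)
  | inv a _ ih =>
    have := neg_mem (ih (cs.geomRep a⁻¹ v))
    rwa [geomRep_apply_inv, neg_sub] at this

theorem sub_geomRep_mem_of_root_mem {t : W} {u : B →₀ ℝ} {L : Submodule ℝ (B →₀ ℝ)}
    (hu : u ∈ L) (ht : cs.geomRep t = M.refl u) (v : B →₀ ℝ) : v - cs.geomRep t v ∈ L := by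
  rw [ht, M.refl_apply, sub_sub_cancel]
  exact L.smul_mem _ hu

theorem root_mem_of_forall_sub_geomRep_mem {t : W} {u : B →₀ ℝ} {L : Submodule ℝ (B →₀ ℝ)}
    (hu : M.cosForm u u = 2) (ht : cs.geomRep t = M.refl u)
    (h : ∀ v, v - cs.geomRep t v ∈ L) : u ∈ L := by
  have := h u
  rw [ht, M.refl_apply, sub_sub_cancel, hu] at this
  exact (L.smul_mem_iff two_ne_zero).1 this

theorem listSpan_map_rootOf_eq_top {l : List W} (hl : ∀ t ∈ l, cs.IsReflection t)
    (h : Subgroup.closure {t | t ∈ l} = ⊤) : listSpan (l.map cs.rootOf) = ⊤ := by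
  have hmem (i : B) : Finsupp.single i 1 ∈ listSpan (l.map cs.rootOf) := by
    refine cs.root_mem_of_forall_sub_geomRep_mem (M.cosForm_single_self i) (cs.geomRep_simple i)
      (cs.sub_geomRep_mem_of_mem_closure (T := {t | t ∈ l}) (fun t ht ↦ ?_)
        (h ▸ Subgroup.mem_top _))
    exact cs.sub_geomRep_mem_of_root_mem
      (mem_listSpan (List.mem_map_of_mem ht)) (hl t ht).geomRep_eq
  rw [eq_top_iff, ← (Finsupp.basisSingleOne (R := ℝ) (ι := B)).span_eq, Submodule.span_le]
  rintro _ ⟨i, rfl⟩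
  simpa using hmem i

variable [Finite W]

theorem listIndep_map_rootOf_iff {l : List W} (hl : ∀ t ∈ l, cs.IsReflection t) :
    l.length = reflLen cs l.prod ↔ ListIndep (l.map cs.rootOf) := by
  have := cs.finite_index
  have hle (l' : List W) (hl' : ∀ t ∈ l', cs.IsReflection t) :
      Module.finrank ℝ (LinearMap.range (1 - cs.geomRep l'.prod)) ≤
        Module.finrank ℝ (listSpan (l'.map cs.rootOf)) := by
    refine Submodule.finrank_mono ?_
    rintro _ ⟨v, rfl⟩
    rw [geomRep_list_prod cs hl']
    exact M.sub_reflProd_mem _ v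
  have hle' (l' : List W) : Module.finrank ℝ (listSpan (l'.map cs.rootOf)) ≤ l'.length := by
    simpa using finrank_listSpan_le (l'.map cs.rootOf)
  have hlen : reflLen cs l.prod = Module.finrank ℝ (LinearMap.range (1 - cs.geomRep l.prod)) := by
    refine le_antisymm ?_ ?_
    · obtain ⟨bs, hbs, hind, hw⟩ := cs.exists_listIndep_reflProd l.prod
      refine Nat.sInf_le ?_
      choose f hf hf' using fun b : {b // cs.IsRoot b} ↦ b.2.exists_reflection
      refine ⟨bs.attach.map fun b ↦ f ⟨b.1, hbs _ b.2⟩, ?_, ?_, ?_⟩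
      · rw [hw, range_one_sub_reflProd cs hind, hind]
        simp
      · simp only [List.mem_map]
        rintro _ ⟨b, -, rfl⟩
        exact hf _
      · refine cs.geomRep_injective ?_
        rw [hw, map_list_prod, List.map_map]
        conv_rhs => rw [← List.attach_map_subtype_val bs]
        rw [CoxeterMatrix.reflProd, List.map_map]
        congr 2
        funext b
        exact hf' _
    · have hne : {k | ∃ l' : List W, l'.length = k ∧ (∀ t ∈ l', cs.IsReflection t) ∧
          l'.prod = l.prod}.Nonempty := ⟨_, l, rfl, hl, rfl⟩
      obtain ⟨l', hk, hl', hprod⟩ := Nat.sInf_mem hne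
      change _ ≤ sInf _
      rw [← hk, ← hprod]
      exact (hle l' hl').trans (hle' l')
  have h1 := hle l hl
  have h2 := hle' l
  constructor
  · intro h
    simp only [ListIndep, List.length_map]
    omega
  · intro h
    rw [hlen, geomRep_list_prod cs hl, range_one_sub_reflProd cs h, h, List.length_map]

theorem mem_redT_iff {l : List W} {w : W} :
    l ∈ RedT cs w ↔
      (∀ t ∈ l, cs.IsReflection t) ∧ l.prod = w ∧ ListIndep (l.map cs.rootOf) := by
  constructor
  · rintro ⟨h1, h2, rfl⟩
    exact ⟨h2, rfl, (cs.listIndep_map_rootOf_iff h2).1 h1⟩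
  · rintro ⟨h2, rfl, h3⟩
    exact ⟨(cs.listIndep_map_rootOf_iff h2).2 h3, h2, rfl⟩

theorem exists_quasiCoxeter_above {x : W} {l : List W} (hl : l ∈ RedT cs x)
    (hP : IsParabolic cs (Subgroup.closure {t | t ∈ l})) :
    ∃ w : W, (∃ l ∈ RedT cs w, Subgroup.closure {t | t ∈ l} = ⊤) ∧ absLe cs x w := by
  classical
  have := cs.finite_index
  have := Fintype.ofFinite B
  obtain ⟨hrefl, rfl, hind⟩ := (cs.mem_redT_iff).1 hl
  obtain ⟨u, S', hS⟩ := hP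
  rw [MonoidHom.map_closure] at hS
  let l' : List W := S'.toFinsetᶜ.toList.map fun j ↦ u * cs.simple j * u⁻¹
  have hrefl' : ∀ t ∈ l', cs.IsReflection t := by
    simp only [l', List.mem_map]
    rintro _ ⟨j, -, rfl⟩
    exact ⟨u, j, rfl⟩
  have hrefl'' : ∀ t ∈ l ++ l', cs.IsReflection t := by
    simp only [List.mem_append]
    rintro t (ht | ht)
    exacts [hrefl t ht, hrefl' t ht]
  have htop : Subgroup.closure {t | t ∈ l ++ l'} = ⊤ := by
    have h1 : Subgroup.map (MulAut.conj u).toMonoidHom (Subgroup.closure (Set.range cs.simple)) =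
        ⊤ := by
      rw [cs.subgroup_closure_range_simple]
      exact Subgroup.map_top_of_surjective _ (MulAut.conj u).surjective
    rw [eq_top_iff, ← h1, MonoidHom.map_closure, Subgroup.closure_le]
    rintro _ ⟨_, ⟨j, rfl⟩, rfl⟩
    by_cases hj : j ∈ S'
    · refine (hS.ge.trans (Subgroup.closure_mono fun t (ht : t ∈ l) ↦
        List.mem_append_left (bs := l') ht)) ?_
      exact Subgroup.subset_closure ⟨_, ⟨j, hj, rfl⟩, rfl⟩
    · refine Subgroup.subset_closure (List.mem_append_right _ ?_)
      simp only [l', List.mem_map]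
      exact ⟨j, by simpa using hj, by simp⟩
  have hspan := cs.listSpan_map_rootOf_eq_top hrefl'' htop
  have hlen : l.length ≤ S'.toFinset.card := by
    have hle : listSpan (l.map cs.rootOf) ≤ Submodule.span ℝ
        (S'.toFinset.image fun j ↦ cs.geomRep u (.single j 1) : Finset (B →₀ ℝ)) := by
      refine listSpan_le.2 fun b hb ↦ ?_
      obtain ⟨t, ht, rfl⟩ := List.mem_map.1 hb
      refine cs.root_mem_of_forall_sub_geomRep_mem (hrefl t ht).isRoot_rootOf.cosForm_self
        (hrefl t ht).geomRep_eq (cs.sub_geomRep_mem_of_mem_closure ?_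
          (hS.le (Subgroup.subset_closure ht)))
      rintro _ ⟨_, ⟨j, hj, rfl⟩, rfl⟩
      refine cs.sub_geomRep_mem_of_root_mem (u := cs.geomRep u (.single j 1)) ?_ ?_
      · exact Submodule.subset_span (by simpa using ⟨j, hj, rfl⟩)
      · simp only [MulEquiv.toMonoidHom_eq_coe, MonoidHom.coe_coe, MulAut.conj_apply, map_mul,
          geomRep_simple, geomRep_conj_refl]
    have h1 := Submodule.finrank_mono hle
    rw [hind, List.length_map] at h1
    exact h1.trans ((finrank_span_finset_le_card _).trans Finset.card_image_le)
  have hind' : ListIndep ((l ++ l').map cs.rootOf) := by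
    refine le_antisymm (finrank_listSpan_le _) ?_
    rw [hspan, finrank_top, Module.finrank_finsupp_self]
    have := Finset.card_add_card_compl S'.toFinset
    simp only [List.length_map, List.length_append, l', Finset.length_toList]
    omega
  have hmem : l ++ l' ∈ RedT cs (l ++ l').prod := cs.mem_redT_iff.2 ⟨hrefl'', rfl, hind'⟩
  have hmem' : l' ∈ RedT cs l'.prod := by
    rw [List.map_append] at hind'
    exact cs.mem_redT_iff.2 ⟨hrefl', rfl, (listIndep_append.1 hind').2.1⟩
  refine ⟨_, ⟨_, hmem, htop⟩, ?_⟩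
  have e1 := hl.1
  have e2 := hmem'.1
  have e3 := hmem.1
  rw [List.length_append] at e3
  rw [absLe, ← e3, ← e1, List.prod_append, inv_mul_cancel_left, ← e2]

end CoxeterSystem

theorem listSpan_mono_of_subset {E : Type*} [AddCommGroup E] [Module ℝ E] {l₁ l₂ : List E}
    (h : l₁ ⊆ l₂) : listSpan l₁ ≤ listSpan l₂ :=
  listSpan_le.2 fun _ hb ↦ mem_listSpan (h hb)

theorem ListIndep.sublist {E : Type*} [AddCommGroup E] [Module ℝ E] {l₁ l₂ : List E}
    (hl : ListIndep l₂) (h : l₁.Sublist l₂) : ListIndep l₁ := by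
  induction h with
  | slnil => exact hl
  | cons a _ ih => exact ih (listIndep_cons.1 hl).2
  | cons_cons a h ih =>
    obtain ⟨h1, h2⟩ := listIndep_cons.1 hl
    exact listIndep_cons.2 ⟨fun h3 ↦ h1 (listSpan_mono_of_subset h.subset h3), ih h2⟩

namespace CoxeterMatrix

variable {B : Type*} (M : CoxeterMatrix B)

/-- A set of nodes which is a union of connected components of the Coxeter diagram. -/
def IsComponents (J : Set B) : Prop := ∀ i ∈ J, ∀ k ∉ J, M i k = 2

variable {M}

theorem IsComponents.compl {J : Set B} (hJ : M.IsComponents J) : M.IsComponents Jᶜ :=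
  fun i hi k hk ↦ (M.symmetric i k).trans (hJ k (not_not.1 hk) i hi)

theorem IsComponents.cosForm_eq_zero {J : Set B} (hJ : M.IsComponents J) {u v : B →₀ ℝ}
    (hu : u ∈ Finsupp.supported ℝ ℝ J) (hv : v ∈ Finsupp.supported ℝ ℝ Jᶜ) :
    M.cosForm u v = 0 := by
  rw [Finsupp.supported_eq_span_single] at hu hv
  induction hu using Submodule.span_induction with
  | zero => simp
  | add x y _ _ hx hy => simp [hx, hy]
  | smul a x _ hx => simp [hx]
  | mem x hx =>
    obtain ⟨i, hi, rfl⟩ := hx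
    induction hv using Submodule.span_induction with
    | zero => simp
    | add x y _ _ hx hy => simp [hx, hy]
    | smul a x _ hx => simp [hx]
    | mem y hy =>
      obtain ⟨k, hk, rfl⟩ := hy
      simp [M.cosForm_single, hJ i hi k hk]

theorem IsComponents.refl_apply_eq {J : Set B} (hJ : M.IsComponents J) {u v : B →₀ ℝ}
    (hu : u ∈ Finsupp.supported ℝ ℝ Jᶜ) (hv : v ∈ Finsupp.supported ℝ ℝ J) :
    M.refl u v = v := by
  rw [M.refl_apply, M.cosForm_comm, hJ.cosForm_eq_zero hv hu, zero_smul, sub_zero]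

open Classical in
/-- The sublist of those vectors of `l` that are supported in `J`. -/
noncomputable def restrict (J : Set B) (l : List (B →₀ ℝ)) : List (B →₀ ℝ) :=
  l.filter (· ∈ Finsupp.supported ℝ ℝ J)

theorem mem_restrict {J : Set B} {l : List (B →₀ ℝ)} {b : B →₀ ℝ} :
    b ∈ restrict J l ↔ b ∈ l ∧ b ∈ Finsupp.supported ℝ ℝ J := by
  simp [restrict]

theorem restrict_sublist (J : Set B) (l : List (B →₀ ℝ)) : (restrict J l).Sublist l :=
  List.filter_sublist

theorem disjoint_supported_compl (J : Set B) :
    Disjoint (Finsupp.supported ℝ ℝ J) (Finsupp.supported ℝ ℝ Jᶜ) :=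
  Finsupp.disjoint_supported_supported disjoint_compl_right

theorem mem_listSpan_restrict {J : Set B} {l : List (B →₀ ℝ)}
    (hl : ∀ b ∈ l, b ∈ Finsupp.supported ℝ ℝ J ∨ b ∈ Finsupp.supported ℝ ℝ Jᶜ)
    {u : B →₀ ℝ} (hu : u ∈ listSpan l) (huJ : u ∈ Finsupp.supported ℝ ℝ J) :
    u ∈ listSpan (restrict J l) := by
  have hle : listSpan l ≤ listSpan (restrict J l) ⊔ Finsupp.supported ℝ ℝ Jᶜ := by
    refine listSpan_le.2 fun b hb ↦ ?_
    rcases hl b hb with h | h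
    · exact Submodule.mem_sup_left (mem_listSpan (mem_restrict.2 ⟨hb, h⟩))
    · exact Submodule.mem_sup_right h
  obtain ⟨y, hy, z, hz, rfl⟩ := Submodule.mem_sup.1 (hle hu)
  have hyJ : y ∈ Finsupp.supported ℝ ℝ J :=
    listSpan_le.2 (fun b hb ↦ (mem_restrict.1 hb).2) hy
  have hzJ : z ∈ Finsupp.supported ℝ ℝ J := by simpa using sub_mem huJ hyJ
  rw [Submodule.disjoint_def.1 (disjoint_supported_compl J) z hzJ hz, add_zero]
  exact hy

theorem IsComponents.reflProd_restrict {J : Set B} (hJ : M.IsComponents J) {l : List (B →₀ ℝ)}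
    (hl : ∀ b ∈ l, b ∈ Finsupp.supported ℝ ℝ J ∨ b ∈ Finsupp.supported ℝ ℝ Jᶜ)
    {v : B →₀ ℝ} (hv : v ∈ Finsupp.supported ℝ ℝ J) :
    M.reflProd (restrict J l) v = M.reflProd l v := by
  have hmem (l : List (B →₀ ℝ)) : M.reflProd (restrict J l) v ∈ Finsupp.supported ℝ ℝ J := by
    have h1 := M.sub_reflProd_mem (restrict J l) v
    have h2 := listSpan_le.2 (fun b hb ↦ (mem_restrict.1 hb).2) h1
    simpa using sub_mem hv h2
  induction l with
  | nil => simp [restrict]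
  | cons b l ih =>
    have ih := ih fun c hc ↦ hl c (List.mem_cons_of_mem _ hc)
    rw [M.reflProd_cons, Module.End.mul_apply, ← ih]
    by_cases hb : b ∈ Finsupp.supported ℝ ℝ J
    · rw [restrict, List.filter_cons_of_pos (by simpa using hb), M.reflProd_cons]
      rfl
    · rw [restrict, List.filter_cons_of_neg (by simpa using hb)]
      exact (hJ.refl_apply_eq ((hl b (by simp)).resolve_left hb) (hmem l)).symm

end CoxeterMatrix

namespace CoxeterSystem

open CoxeterMatrix

variable {B W : Type*} [Group W] {M : CoxeterMatrix B} {cs : CoxeterSystem M W}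

theorem geomRep_mem_supported {J : Set B} (hJ : M.IsComponents J) (w : W) {v : B →₀ ℝ}
    (hv : v ∈ Finsupp.supported ℝ ℝ J) : cs.geomRep w v ∈ Finsupp.supported ℝ ℝ J := by
  induction w using cs.simple_induction_left with
  | one => simpa
  | mul_simple_left w i ih =>
    rw [map_mul, Module.End.mul_apply, geomRep_simple]
    by_cases hi : i ∈ J
    · rw [M.refl_apply]
      exact sub_mem ih (Submodule.smul_mem _ _ (Finsupp.single_mem_supported ℝ _ hi))
    · rwa [hJ.refl_apply_eq (Finsupp.single_mem_supported ℝ _ hi) ih]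

theorem IsRoot.mem_supported_or {J : Set B} (hJ : M.IsComponents J) {u : B →₀ ℝ}
    (hu : cs.IsRoot u) : u ∈ Finsupp.supported ℝ ℝ J ∨ u ∈ Finsupp.supported ℝ ℝ Jᶜ := by
  obtain ⟨w, i, rfl⟩ := hu
  by_cases hi : i ∈ J
  · exact .inl (geomRep_mem_supported hJ w (Finsupp.single_mem_supported ℝ _ hi))
  · exact .inr (geomRep_mem_supported hJ.compl w (Finsupp.single_mem_supported ℝ _ hi))

open Classical in
/-- The sign character of `W` that is `-1` on the conjugacy class of the simple reflection `i`
and `1` on all other reflections. -/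
noncomputable def conjSign (cs : CoxeterSystem M W) (i : B) : W →* ℤˣ :=
  cs.lift ⟨fun j ↦ if IsConj (cs.simple i) (cs.simple j) then -1 else 1, by
    intro j k
    by_cases h : IsConj (cs.simple j) (cs.simple k)
    · have : IsConj (cs.simple i) (cs.simple j) ↔ IsConj (cs.simple i) (cs.simple k) :=
        ⟨fun h' ↦ h'.trans h, fun h' ↦ h'.trans h.symm⟩
      simp only [this]
      split_ifs <;> simp
    · obtain ⟨m, hm⟩ : Even (M j k) := by
        by_contra hodd
        obtain ⟨m, hm⟩ := Nat.not_even_iff_odd.1 hodd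
        refine h ?_
        have h1 := cs.simple_mul_simple_pow j k
        have h2 : (cs.simple j * cs.simple k) ^ m * cs.simple j =
            cs.simple k * (cs.simple j * cs.simple k) ^ m := by
          have h3 : cs.simple k * (cs.simple j * cs.simple k) ^ m =
              (cs.simple k * cs.simple j) ^ m * cs.simple k := by
            have : SemiconjBy (cs.simple k) (cs.simple j * cs.simple k)
                (cs.simple k * cs.simple j) := by simp [SemiconjBy, mul_assoc]
            exact this.pow_right m
          have h4 : (cs.simple k * cs.simple j) ^ m = ((cs.simple j * cs.simple k) ^ m)⁻¹ := by
            rw [← inv_pow]; simp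
          rw [h3, h4, eq_inv_mul_iff_mul_eq, ← mul_assoc, ← pow_add, ← two_mul]
          change _ ^ M j k = 1 at h1
          rw [hm, pow_succ] at h1
          have := mul_eq_one_iff_eq_inv.1 h1
          rw [this]
          simp
        exact isConj_iff.2 ⟨(cs.simple j * cs.simple k) ^ m, by rw [h2]; group⟩
      rw [show M j k = 2 * m by omega, pow_mul]
      dsimp only
      split_ifs <;> simp⟩

theorem conjSign_simple_of_isConj {i j : B} (h : IsConj (cs.simple i) (cs.simple j)) :
    cs.conjSign i (cs.simple j) = -1 := by
  classical
  exact (cs.lift_apply_simple _ j).trans (if_pos h)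

theorem conjSign_simple_of_not_isConj {i j : B} (h : ¬IsConj (cs.simple i) (cs.simple j)) :
    cs.conjSign i (cs.simple j) = 1 := by
  classical
  exact (cs.lift_apply_simple _ j).trans (if_neg h)

theorem exists_isConj_of_closure_eq_top {T : Set W} (hT : ∀ t ∈ T, cs.IsReflection t)
    (h : Subgroup.closure T = ⊤) (i : B) : ∃ t ∈ T, IsConj t (cs.simple i) := by
  classical
  by_contra! hne
  have hle : Subgroup.closure T ≤ (cs.conjSign i).ker := by
    rw [Subgroup.closure_le]
    intro t ht
    obtain ⟨w, j, rfl⟩ := hT t ht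
    have h1 : ¬IsConj (cs.simple i) (cs.simple j) := fun hc ↦
      hne _ ht (hc.trans (isConj_iff.2 ⟨w, rfl⟩)).symm
    simp [MonoidHom.mem_ker, conjSign_simple_of_not_isConj h1]
  have : cs.conjSign i (cs.simple i) = 1 := (h ▸ hle) (Subgroup.mem_top _)
  rw [conjSign_simple_of_isConj (IsConj.refl _)] at this
  exact absurd this (by decide)

/-- If a set of reflections generates the group, then every root is, up to sign, in the orbit of
one of the roots of the generators. -/
theorem IsRoot.exists_eq_or_eq_neg {l : List W} (hl : ∀ t ∈ l, cs.IsReflection t)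
    (h : Subgroup.closure {t | t ∈ l} = ⊤) {u : B →₀ ℝ} (hu : cs.IsRoot u) :
    ∃ b ∈ l.map cs.rootOf, ∃ g, u = cs.geomRep g b ∨ u = -cs.geomRep g b := by
  obtain ⟨w, i, rfl⟩ := hu
  obtain ⟨t, ht, hc⟩ := exists_isConj_of_closure_eq_top (cs := cs) (T := {t | t ∈ l}) hl h i
  obtain ⟨g, hg⟩ := isConj_iff.1 hc
  have hr := (hl t ht).isRoot_rootOf
  refine ⟨_, List.mem_map_of_mem ht, w * g, ?_⟩
  have h1 := congrArg cs.geomRep hg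
  rw [map_mul, map_mul, (hl t ht).geomRep_eq, geomRep_conj_refl, geomRep_simple] at h1
  rcases M.eq_or_eq_neg_of_refl_eq (M.cosForm_single_self i) (hr.geomRep g).cosForm_self h1.symm
    with h2 | h2
  · left; rw [h2]; simp
  · right; rw [h2]; simp

end CoxeterSystem

theorem mem_closure_pair_of_mul_self {G : Type*} [Group G] {a b g : G} (ha : a * a = 1)
    (hb : b * b = 1) (hg : g ∈ Subgroup.closure {a, b}) :
    ∃ z : ℤ, g = (a * b) ^ z ∨ g = (a * b) ^ z * a := by
  have key (x : G) (hx : ∃ z : ℤ, x = (a * b) ^ z ∨ x = (a * b) ^ z * a) (y : G)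
      (hy : y = a ∨ y = b) : ∃ z : ℤ, x * y = (a * b) ^ z ∨ x * y = (a * b) ^ z * a := by
    obtain ⟨z, rfl | rfl⟩ := hx <;> obtain rfl | rfl := hy
    · exact ⟨z, .inr rfl⟩
    · refine ⟨z - 1, .inr ?_⟩
      rw [zpow_sub_one, mul_inv_rev, inv_eq_of_mul_eq_one_left hb, mul_assoc, mul_assoc]
      simp
    · exact ⟨z, .inl (by rw [mul_assoc, ha, mul_one])⟩
    · exact ⟨z + 1, .inl (by rw [zpow_add_one, mul_assoc])⟩
  induction hg using Subgroup.closure_induction_right with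
  | one => exact ⟨0, .inl (zpow_zero _).symm⟩
  | mul_right x _ y hy ih => exact key x ih y hy
  | mul_inv_cancel x _ y hy ih =>
    have : y⁻¹ = y := by
      rcases hy with rfl | rfl
      exacts [inv_eq_of_mul_eq_one_left ha, inv_eq_of_mul_eq_one_left hb]
    rw [this]
    exact key x ih y hy

namespace CoxeterSystem

open CoxeterMatrix

variable {B W : Type*} [Group W] {M : CoxeterMatrix B} {cs : CoxeterSystem M W}

theorem IsReflection.lengthParity {t : W} (ht : cs.IsReflection t) :
    cs.lengthParity t = Multiplicative.ofAdd 1 := by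
  rw [cs.lengthParity_eq_ofAdd_length, (ZMod.natCast_eq_one_iff_odd).2 ht.odd_length]

theorem IsReflection.ne_mul_zpow {t a b : W} (ht : cs.IsReflection t) (ha : cs.IsReflection a)
    (hb : cs.IsReflection b) (z : ℤ) : t ≠ (a * b) ^ z := by
  intro h
  have := congrArg cs.lengthParity h
  rw [map_zpow, map_mul, ha.lengthParity, hb.lengthParity, ht.lengthParity, ← ofAdd_add,
    show (1 + 1 : ZMod 2) = 0 from rfl, ofAdd_zero, one_zpow] at this
  exact absurd this (by decide)

theorem IsReflection.eq_zpow_mul_of_mem_closure_pair {t a b : W} (ht : cs.IsReflection t)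
    (ha : cs.IsReflection a) (hb : cs.IsReflection b) (h : t ∈ Subgroup.closure {a, b}) :
    ∃ z : ℤ, t = (a * b) ^ z * a := by
  obtain ⟨z, h | h⟩ := mem_closure_pair_of_mul_self ha.mul_self hb.mul_self h
  · exact absurd h (ht.ne_mul_zpow ha hb z)
  · exact ⟨z, h⟩

variable (cs)

open Classical in
/-- The sublist of those elements of `l` whose root is supported in `J`. -/
noncomputable def restrict (J : Set B) (l : List W) : List W :=
  l.filter (cs.rootOf · ∈ Finsupp.supported ℝ ℝ J)

theorem mem_restrict {J : Set B} {l : List W} {t : W} :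
    t ∈ cs.restrict J l ↔ t ∈ l ∧ cs.rootOf t ∈ Finsupp.supported ℝ ℝ J := by
  simp [restrict]

theorem restrict_append (J : Set B) (l₁ l₂ : List W) :
    cs.restrict J (l₁ ++ l₂) = cs.restrict J l₁ ++ cs.restrict J l₂ := by
  simp [restrict]

theorem map_rootOf_restrict (J : Set B) (l : List W) :
    (cs.restrict J l).map cs.rootOf = CoxeterMatrix.restrict J (l.map cs.rootOf) := by
  rw [restrict, CoxeterMatrix.restrict, List.filter_map]
  rfl

variable {cs}

theorem mem_supported_or_of_mem_map_rootOf {J : Set B} (hJ : M.IsComponents J) {l : List W}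
    (hl : ∀ t ∈ l, cs.IsReflection t) :
    ∀ b ∈ l.map cs.rootOf, b ∈ Finsupp.supported ℝ ℝ J ∨ b ∈ Finsupp.supported ℝ ℝ Jᶜ :=
  fun _ hb ↦ (cs.isRoot_of_mem_map_rootOf hl hb).mem_supported_or hJ

theorem geomRep_restrict_prod_of_mem {J : Set B} (hJ : M.IsComponents J) {l : List W}
    (hl : ∀ t ∈ l, cs.IsReflection t) {v : B →₀ ℝ} (hv : v ∈ Finsupp.supported ℝ ℝ J) :
    cs.geomRep (cs.restrict J l).prod v = cs.geomRep l.prod v := by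
  rw [cs.geomRep_list_prod hl, cs.geomRep_list_prod fun t ht ↦ hl t ((cs.mem_restrict).1 ht).1,
    map_rootOf_restrict, hJ.reflProd_restrict (mem_supported_or_of_mem_map_rootOf hJ hl) hv]

theorem IsReflection.geomRep_apply_of_mem_compl {J : Set B} (hJ : M.IsComponents J) {t : W}
    (ht : cs.IsReflection t) (htJ : cs.rootOf t ∈ Finsupp.supported ℝ ℝ J) {v : B →₀ ℝ}
    (hv : v ∈ Finsupp.supported ℝ ℝ Jᶜ) : cs.geomRep t v = v := by
  rw [ht.geomRep_eq]
  exact hJ.compl.refl_apply_eq (by rwa [compl_compl]) hv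

theorem geomRep_apply_of_mem_closure_of_mem_compl {J : Set B} (hJ : M.IsComponents J) {T : Set W}
    (hT : ∀ t ∈ T, cs.IsReflection t ∧ cs.rootOf t ∈ Finsupp.supported ℝ ℝ J) {g : W}
    (hg : g ∈ Subgroup.closure T) {v : B →₀ ℝ} (hv : v ∈ Finsupp.supported ℝ ℝ Jᶜ) :
    cs.geomRep g v = v := by
  induction hg using Subgroup.closure_induction with
  | mem t ht => exact (hT t ht).1.geomRep_apply_of_mem_compl hJ (hT t ht).2 hv
  | one => simp
  | mul a b _ _ iha ihb => rw [map_mul, Module.End.mul_apply, ihb, iha]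
  | inv a _ ih =>
    conv_lhs => rw [← ih]
    rw [geomRep_inv_apply]

variable [Finite W]

theorem eq_of_geomRep_apply_eq {J : Set B} {g h : W}
    (h₁ : ∀ v ∈ Finsupp.supported ℝ ℝ J, cs.geomRep g v = cs.geomRep h v)
    (h₂ : ∀ v ∈ Finsupp.supported ℝ ℝ Jᶜ, cs.geomRep g v = cs.geomRep h v) : g = h := by
  refine cs.geomRep_injective (Finsupp.lhom_ext' fun i ↦ LinearMap.ext_ring ?_)
  by_cases hi : i ∈ J
  · exact h₁ _ (Finsupp.single_mem_supported ℝ _ hi)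
  · exact h₂ _ (Finsupp.single_mem_supported ℝ _ hi)

theorem restrict_prod_congr {J : Set B} (hJ : M.IsComponents J) {l l' : List W}
    (hl : ∀ t ∈ l, cs.IsReflection t) (hl' : ∀ t ∈ l', cs.IsReflection t)
    (h : l.prod = l'.prod) : (cs.restrict J l).prod = (cs.restrict J l').prod := by
  have key (l : List W) (hl : ∀ t ∈ l, cs.IsReflection t) (v : B →₀ ℝ)
      (hv : v ∈ Finsupp.supported ℝ ℝ Jᶜ) : cs.geomRep (cs.restrict J l).prod v = v := by
    refine geomRep_apply_of_mem_closure_of_mem_compl hJ (T := {t | t ∈ cs.restrict J l})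
      (fun t ht ↦ ?_)
      (list_prod_mem fun t ht ↦ Subgroup.subset_closure ht) hv
    have := (cs.mem_restrict).1 ht
    exact ⟨hl t this.1, this.2⟩
  refine eq_of_geomRep_apply_eq (cs := cs) (J := J) (fun v hv ↦ ?_) fun v hv ↦ ?_
  · rw [geomRep_restrict_prod_of_mem hJ hl hv, geomRep_restrict_prod_of_mem hJ hl' hv, h]
  · rw [key l hl v hv, key l' hl' v hv]

theorem IsReflection.mem_closure_restrict {J : Set B} (hJ : M.IsComponents J) {l : List W}
    (hl : ∀ t ∈ l, cs.IsReflection t) (htop : Subgroup.closure {t | t ∈ l} = ⊤) {t : W}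
    (ht : cs.IsReflection t) (htJ : cs.rootOf t ∈ Finsupp.supported ℝ ℝ J) :
    t ∈ Subgroup.closure {t | t ∈ cs.restrict J l} := by
  have key (g : W) (hg : g ∈ Subgroup.closure {t | t ∈ l}) :
      ∃ h ∈ Subgroup.closure {t | t ∈ cs.restrict J l},
        ∀ v ∈ Finsupp.supported ℝ ℝ J, cs.geomRep g v = cs.geomRep h v := by
    induction hg using Subgroup.closure_induction with
    | mem t ht =>
      by_cases htJ : cs.rootOf t ∈ Finsupp.supported ℝ ℝ J
      · exact ⟨t, Subgroup.subset_closure ((cs.mem_restrict).2 ⟨ht, htJ⟩), fun _ _ ↦ rfl⟩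
      · have := ((hl t ht).isRoot_rootOf.mem_supported_or hJ).resolve_left htJ
        refine ⟨1, one_mem _, fun v hv ↦ ?_⟩
        rw [(hl t ht).geomRep_apply_of_mem_compl hJ.compl this (by rwa [compl_compl])]
        simp
    | one => exact ⟨1, one_mem _, fun _ _ ↦ rfl⟩
    | mul a b _ _ iha ihb =>
      obtain ⟨a', ha', ha⟩ := iha
      obtain ⟨b', hb', hb⟩ := ihb
      refine ⟨a' * b', mul_mem ha' hb', fun v hv ↦ ?_⟩
      rw [map_mul, map_mul, Module.End.mul_apply, Module.End.mul_apply, hb v hv,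
        ha _ (geomRep_mem_supported hJ _ hv)]
    | inv a _ ih =>
      obtain ⟨a', ha', ha⟩ := ih
      refine ⟨a'⁻¹, inv_mem ha', fun v hv ↦ ?_⟩
      have := ha _ (geomRep_mem_supported hJ (cs := cs) a'⁻¹ hv)
      rw [geomRep_apply_inv] at this
      conv_lhs => rw [← this]
      rw [geomRep_inv_apply]
  obtain ⟨h, hh, h1⟩ := key t (htop ▸ Subgroup.mem_top _)
  rwa [eq_of_geomRep_apply_eq (cs := cs) h1 fun v hv ↦ ?_]
  rw [ht.geomRep_apply_of_mem_compl hJ htJ hv,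
    geomRep_apply_of_mem_closure_of_mem_compl hJ (fun t ht ↦ ?_) hh hv]
  have := (cs.mem_restrict).1 ht
  exact ⟨hl t this.1, this.2⟩

theorem IsReflection.eq_of_rootOf_eq {t t' : W} (ht : cs.IsReflection t)
    (ht' : cs.IsReflection t') (h : cs.rootOf t = cs.rootOf t' ∨ cs.rootOf t = -cs.rootOf t') :
    t = t' := by
  refine cs.geomRep_injective ?_
  rw [ht.geomRep_eq, ht'.geomRep_eq]
  rcases h with h | h <;> rw [h]
  rw [M.refl_neg]

theorem eq_or_eq_neg_of_eq_smul {u v : B →₀ ℝ} (hu : M.cosForm u u = 2) (hv : M.cosForm v v = 2)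
    {a : ℝ} (h : u = a • v) : u = v ∨ u = -v := by
  have : a ^ 2 = 1 := by
    rw [h] at hu
    simp only [map_smul, LinearMap.smul_apply, hv, smul_eq_mul] at hu
    linarith
  rcases sq_eq_sq_iff_eq_or_eq_neg.1 (this.trans (one_pow 2).symm) with rfl | rfl
  · simp [h]
  · simp [h]

end CoxeterSystem

namespace CoxeterSystem

open CoxeterMatrix

variable {B W : Type*} [Group W] [Finite W] {M : CoxeterMatrix B} {cs : CoxeterSystem M W}

omit [Finite W] in
theorem length_restrict_of_span_eq_top {J : Set B} (hJ : M.IsComponents J) {l : List W}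
    (hl : ∀ t ∈ l, cs.IsReflection t) (hind : ListIndep (l.map cs.rootOf))
    (hspan : listSpan (l.map cs.rootOf) = ⊤) :
    (cs.restrict J l).length = Module.finrank ℝ (Finsupp.supported ℝ ℝ J) := by
  have h1 : ListIndep ((cs.restrict J l).map cs.rootOf) := by
    rw [map_rootOf_restrict]
    exact hind.sublist (restrict_sublist _ _)
  have h2 : listSpan ((cs.restrict J l).map cs.rootOf) = Finsupp.supported ℝ ℝ J := by
    rw [map_rootOf_restrict]
    refine le_antisymm (listSpan_le.2 fun b hb ↦ (CoxeterMatrix.mem_restrict.1 hb).2) fun v hv ↦ ?_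
    exact mem_listSpan_restrict (mem_supported_or_of_mem_map_rootOf hJ hl)
      (hspan ▸ Submodule.mem_top) hv
  rw [← h2, h1, List.length_map]

theorem IsReflection.mem_closure_of_isComponents_pair {i j : B} (hij : i ≠ j)
    (hJ : M.IsComponents {i, j}) {l₁ l₂ l : List W} (hl₁ : ∀ t ∈ l₁, cs.IsReflection t)
    (hl₂ : ∀ t ∈ l₂, cs.IsReflection t) (hl : ∀ t ∈ l, cs.IsReflection t)
    (htop : Subgroup.closure {t | t ∈ l} = ⊤) (hind : ListIndep (l.map cs.rootOf))
    (hind' : ListIndep ((l₁ ++ l₂).map cs.rootOf)) (hprod : (l₁ ++ l₂).prod = l.prod) {t : W}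
    (ht : cs.IsReflection t) (htJ : cs.rootOf t ∈ Finsupp.supported ℝ ℝ {i, j})
    (htl : cs.rootOf t ∈ listSpan (l₁.map cs.rootOf)) : t ∈ Subgroup.closure {t | t ∈ l₁} := by
  classical
  have := cs.finite_index
  have hl₁₂ : ∀ t ∈ l₁ ++ l₂, cs.IsReflection t := fun t ht ↦
    (List.mem_append.1 ht).elim (hl₁ t) (hl₂ t)
  have hrank : Module.finrank ℝ (Finsupp.supported ℝ ℝ ({i, j} : Set B)) = 2 := by
    rw [(Finsupp.supportedEquivFinsupp _).finrank_eq, Module.finrank_finsupp_self,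
      ← Nat.card_eq_fintype_card, Nat.card_coe_set_eq, Set.ncard_pair hij]
  have hlen := length_restrict_of_span_eq_top hJ hl hind (cs.listSpan_map_rootOf_eq_top hl htop)
  rw [hrank] at hlen
  obtain ⟨a, b, hab⟩ := List.length_eq_two.1 hlen
  have ha : cs.IsReflection a := hl a ((cs.mem_restrict (J := {i, j})).1 (hab ▸ by simp)).1
  have hb : cs.IsReflection b := hl b ((cs.mem_restrict (J := {i, j})).1 (hab ▸ by simp)).1
  have hmem (t : W) (ht : cs.IsReflection t)
      (htJ : cs.rootOf t ∈ Finsupp.supported ℝ ℝ {i, j}) : ∃ z : ℤ, t = (a * b) ^ z * a := by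
    refine ht.eq_zpow_mul_of_mem_closure_pair ha hb ?_
    have := ht.mem_closure_restrict hJ hl htop htJ
    rw [hab] at this
    convert this using 2
    ext; simp
  have hpr := restrict_prod_congr hJ hl₁₂ hl hprod
  have hindr : ListIndep ((cs.restrict {i, j} (l₁ ++ l₂)).map cs.rootOf) := by
    rw [map_rootOf_restrict]
    exact hind'.sublist (restrict_sublist _ _)
  have hlen' : (cs.restrict {i, j} (l₁ ++ l₂)).length ≤ 2 := by
    rw [← hrank, ← List.length_map (f := cs.rootOf), ← hindr]
    refine Submodule.finrank_mono (listSpan_le.2 fun b hb ↦ ?_)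
    rw [map_rootOf_restrict] at hb
    exact (CoxeterMatrix.mem_restrict.1 hb).2
  rw [restrict_append, List.length_append] at hlen'
  have hspan : cs.rootOf t ∈ listSpan ((cs.restrict {i, j} l₁).map cs.rootOf) := by
    rw [map_rootOf_restrict]
    exact mem_listSpan_restrict (mem_supported_or_of_mem_map_rootOf hJ hl₁) htl htJ
  have hsub : ∀ c ∈ cs.restrict {i, j} l₁, c ∈ l₁ ∧ cs.IsReflection c ∧
      cs.rootOf c ∈ Finsupp.supported ℝ ℝ {i, j} := fun c hc ↦ by
    have := (cs.mem_restrict).1 hc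
    exact ⟨this.1, hl₁ c this.1, this.2⟩
  match hr : cs.restrict {i, j} l₁ with
  | [] =>
    rw [hr, List.map_nil, listSpan_nil, Submodule.mem_bot] at hspan
    have := ht.isRoot_rootOf.cosForm_self
    simp [hspan] at this
  | [c] =>
    obtain ⟨hc, hcr, -⟩ := hsub c (by simp [hr])
    rw [hr, List.map_singleton, listSpan_cons, listSpan_nil, sup_bot_eq,
      Submodule.mem_span_singleton] at hspan
    obtain ⟨x, hx⟩ := hspan
    rw [ht.eq_of_rootOf_eq hcr (eq_or_eq_neg_of_eq_smul ht.isRoot_rootOf.cosForm_self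
      hcr.isRoot_rootOf.cosForm_self hx.symm)]
    exact Subgroup.subset_closure hc
  | [c, d] =>
    obtain ⟨hc, hcr, hcJ⟩ := hsub c (by simp [hr])
    obtain ⟨hd, hdr, -⟩ := hsub d (by simp [hr])
    have hnil : cs.restrict {i, j} l₂ = [] := by
      rw [hr] at hlen'
      exact List.eq_nil_of_length_eq_zero (by simpa using hlen')
    rw [restrict_append, hr, hnil, hab] at hpr
    simp only [List.append_nil, List.prod_cons, List.prod_nil, mul_one] at hpr
    obtain ⟨y, hy⟩ := hmem t ht htJ
    obtain ⟨z, hz⟩ := hmem c hcr hcJ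
    have : t = (c * d) ^ (y - z) * c := by
      rw [hpr]
      conv_rhs => rw [hz]
      rw [← mul_assoc, ← zpow_add, sub_add_cancel, ← hy]
    have hcm : c ∈ Subgroup.closure {t | t ∈ l₁} := Subgroup.subset_closure hc
    have hdm : d ∈ Subgroup.closure {t | t ∈ l₁} := Subgroup.subset_closure hd
    rw [this]
    exact mul_mem (zpow_mem (mul_mem hcm hdm) _) hcm
  | _ :: _ :: _ :: _ => simp [hr] at hlen'; omega

end CoxeterSystem

namespace CoxeterMatrix

variable {B : Type*} (M : CoxeterMatrix B)

theorem cosForm_single_le_of_le {i j : B} {k : ℕ} (hk : 0 < k) (h : k ≤ M i j) :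
    M.cosForm (.single i 1) (.single j 1) ≤ -2 * Real.cos (Real.pi / k) := by
  rw [M.cosForm_single]
  have hk' : (0 : ℝ) < k := by exact_mod_cast hk
  have h1 : (k : ℝ) ≤ M i j := by exact_mod_cast h
  have h2 : Real.pi / M i j ≤ Real.pi / k := by gcongr
  have := Real.cos_le_cos_of_nonneg_of_le_pi (by positivity)
    (div_le_self Real.pi_pos.le (by exact_mod_cast hk)) h2
  linarith

theorem trace_refl_mul_refl [Finite B] {u v : B →₀ ℝ} (hu : M.cosForm u u = 2)
    (hv : M.cosForm v v = 2) : LinearMap.trace ℝ (B →₀ ℝ) (M.refl u * M.refl v) =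
      Nat.card B - 4 + M.cosForm u v ^ 2 := by
  have := Fintype.ofFinite B
  have h : M.refl u * M.refl v = LinearMap.id + (-M.cosForm u).smulRight u +
      (-M.cosForm v).smulRight v + (M.cosForm u v • M.cosForm v).smulRight u := by
    refine LinearMap.ext fun x ↦ ?_
    simp [M.refl_apply]
    module
  rw [h, map_add, map_add, map_add, LinearMap.trace_id, LinearMap.trace_smulRight,
    LinearMap.trace_smulRight, LinearMap.trace_smulRight, LinearMap.neg_apply, LinearMap.neg_apply,
    LinearMap.smul_apply, hu, hv, M.cosForm_comm v u, Module.finrank_finsupp_self,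
    Nat.card_eq_fintype_card, smul_eq_mul]
  ring

/-- The nodes of the Coxeter diagram all of whose edges have label at most `5`. -/
def smallNodes : Set B := {i | ∀ j, M i j ≤ 5}

end CoxeterMatrix

namespace CoxeterSystem

open CoxeterMatrix

variable {B W : Type*} [Group W] [Finite W] {M : CoxeterMatrix B} (cs : CoxeterSystem M W)

include cs

theorem two_le_matrix {i j : B} (hij : i ≠ j) : 2 ≤ M i j :=
  M.two_le hij (cs.matrix_ne_zero i j)

theorem matrix_eq_two_of_six_le {i j k : B} (hij : 6 ≤ M i j) (hki : k ≠ i) (hkj : k ≠ j) :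
    M i k = 2 := by
  by_contra hne
  have hij' : i ≠ j := by
    rintro rfl
    have := M.diagonal i
    change 6 ≤ M.M i i at hij
    omega
  have h3 : 3 ≤ M i k := by
    have : 2 ≤ M.M i k := cs.two_le_matrix hki.symm
    change 3 ≤ M.M i k
    omega
  have e1 := M.cosForm_single_le_of_le (by norm_num) h3
  have e2 := M.cosForm_single_le_of_le (by norm_num) (cs.two_le_matrix hkj)
  have e3 := M.cosForm_single_le_of_le (by norm_num) hij
  push_cast at e1 e2 e3
  rw [Real.cos_pi_div_three] at e1
  rw [Real.cos_pi_div_two] at e2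
  rw [Real.cos_pi_div_six] at e3
  have hs : √3 ^ 2 = (3 : ℝ) := Real.sq_sqrt (by norm_num)
  have hs0 : 0 < √(3 : ℝ) := by positivity
  set v : B →₀ ℝ := .single k 1 + (2 : ℝ) • .single i 1 + √3 • .single j 1 with hv
  have hv0 : v ≠ 0 := by
    intro h
    have := DFunLike.congr_fun h k
    simp [hv, hki.symm, hkj.symm] at this
  have := cs.cosForm_self_pos hv0
  simp only [hv, map_add, map_smul, LinearMap.add_apply, LinearMap.smul_apply, smul_eq_mul,
    M.cosForm_single_self, M.cosForm_comm (.single j 1) (.single k 1),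
    M.cosForm_comm (.single j 1) (.single i 1), M.cosForm_comm (.single k 1) (.single i 1)] at this
  nlinarith

theorem isComponents_pair {i j : B} (hij : 6 ≤ M i j) : M.IsComponents {i, j} := by
  have hji : 6 ≤ M j i := hij.trans (M.symmetric i j).le
  rintro k (rfl | rfl) l hl <;> simp only [Set.mem_insert_iff, Set.mem_singleton_iff, not_or] at hl
  · exact cs.matrix_eq_two_of_six_le hij hl.1 hl.2
  · exact cs.matrix_eq_two_of_six_le hji hl.2 hl.1

theorem isComponents_smallNodes : M.IsComponents M.smallNodes := by
  intro i hi k hk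
  simp only [smallNodes, Set.mem_ofPred_eq, not_forall, not_le] at hi hk
  obtain ⟨j, hj⟩ := hk
  have hik : i ≠ k := fun h ↦ by
    subst h
    exact absurd (hi j) (by omega)
  have hij : i ≠ j := fun h ↦ by
    subst h
    have h1 := hi k
    have h2 : M.M i k = M.M k i := M.symmetric i k
    change M.M i k ≤ 5 at h1
    change 5 < M.M k i at hj
    omega
  exact (M.symmetric i k).trans (cs.matrix_eq_two_of_six_le (show 6 ≤ M k j from hj) hik hij)

end CoxeterSystem

namespace CoxeterSystem

open CoxeterMatrix
open scoped goldenRatio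

variable {B W : Type*} [Group W] [Finite W] {M : CoxeterMatrix B} (cs : CoxeterSystem M W)

theorem exists_parabolic_of_orthogonal (L : Submodule ℝ (B →₀ ℝ)) :
    ∃ (g : W) (J : Set B), (∀ j ∈ J, cs.geomRep g (.single j 1) ∈ L) ∧
      ∀ w, (∀ x, (∀ y ∈ L, M.cosForm y x = 0) → cs.geomRep w x = x) →
        g⁻¹ * w * g ∈ Subgroup.closure (cs.simple '' J) := by
  have := cs.finite_index
  obtain ⟨g, J, h1, h2⟩ := cs.exists_parabolic_of_submodule (M.cosForm.orthogonal L)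
  refine ⟨g, J, fun j hj ↦ ?_, fun w hw ↦ h2 w fun x hx ↦ hw x hx⟩
  rw [← LinearMap.BilinForm.orthogonal_orthogonal cs.cosForm_nondegenerate M.isRefl_cosForm L]
  intro x hx
  change M.cosForm x _ = 0
  rw [M.cosForm_comm]
  exact h1 j hj x hx

omit [Finite W] in
theorem trace_geomRep_conj (g w : W) :
    LinearMap.trace ℝ _ (cs.geomRep (g⁻¹ * w * g)) = LinearMap.trace ℝ _ (cs.geomRep w) := by
  rw [cs.geomRep.map_mul, LinearMap.trace_mul_comm, ← cs.geomRep.map_mul]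
  simp

theorem trace_geomRep_simple_mul_simple_pow {r : ℕ} (hr : r ≤ 2) (i j : B) :
    LinearMap.trace ℝ _ (cs.geomRep ((cs.simple i * cs.simple j) ^ r)) = Nat.card B - 4 +
      (if r = 0 then 2 else if r = 1 then M.cosForm (.single i 1) (.single j 1) else
        2 - M.cosForm (.single i 1) (.single j 1) ^ 2) ^ 2 := by
  have := cs.finite_index
  have := Fintype.ofFinite B
  have hi := M.cosForm_single_self i
  have hj := M.cosForm_single_self j
  interval_cases r
  · simp only [pow_zero, map_one, ↓reduceIte]
    rw [LinearMap.trace_one, Module.finrank_finsupp_self, Nat.card_eq_fintype_card]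
    ring
  · simp only [pow_one, map_mul, geomRep_simple, one_ne_zero, ↓reduceIte]
    exact M.trace_refl_mul_refl hi hj
  · have h : cs.geomRep ((cs.simple i * cs.simple j) ^ 2) = M.refl (.single i 1) *
        M.refl (cs.geomRep (cs.simple j) (.single i 1)) := by
      rw [← geomRep_conj_refl, ← geomRep_simple cs i, ← map_mul, ← map_mul, ← map_mul]
      congr 1
      simp [pow_two, mul_assoc]
    rw [h, M.trace_refl_mul_refl hi (by rw [cosForm_geomRep, hi]), geomRep_simple, M.refl_apply,
      map_sub, map_smul, hi, M.cosForm_comm (.single j 1)]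
    simp
    ring

variable {cs}

theorem cosForm_simple_sq {i j : B} (h0 : M i j ≠ 0) (h5 : M i j ≤ 5) :
    M.cosForm (.single i 1) (.single j 1) ^ 2 ∈ ({0, 1, 2, φ ^ 2, 4} : Set ℝ) := by
  rw [M.cosForm_single]
  change M.M i j ≠ 0 at h0
  change M.M i j ≤ 5 at h5
  have h2 : √2 ^ 2 = (2 : ℝ) := Real.sq_sqrt (by norm_num)
  interval_cases h : M.M i j
  · exact absurd rfl h0
  · norm_num
  · norm_num
  · norm_num [Real.cos_pi_div_three]
  · simp only [Nat.cast_ofNat, Real.cos_pi_div_four, mul_pow, div_pow, h2]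
    norm_num
  · right; right; right; left
    simp only [Nat.cast_ofNat, Real.cos_pi_div_five, Real.goldenRatio]
    ring

theorem IsRoot.cosForm_sq_mem {u v : B →₀ ℝ} (hu : cs.IsRoot u) (hv : cs.IsRoot v)
    (huJ : u ∈ Finsupp.supported ℝ ℝ M.smallNodes) (hvJ : v ∈ Finsupp.supported ℝ ℝ M.smallNodes) :
    M.cosForm u v ^ 2 ∈ ({0, 1, 2, φ ^ 2, (φ - 1) ^ 2, 4} : Set ℝ) := by
  classical
  have := cs.finite_index
  have hcomp := cs.isComponents_smallNodes
  obtain ⟨s, hs, hsu⟩ := hu.exists_reflection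
  obtain ⟨t, ht, htv⟩ := hv.exists_reflection
  obtain ⟨g, J, h1, h2⟩ := cs.exists_parabolic_of_orthogonal (Submodule.span ℝ {u, v})
  have hsmall (j : B) (hj : j ∈ J) : j ∈ M.smallNodes := by
    by_contra hj'
    have h3 : cs.geomRep g (.single j 1) ∈ Finsupp.supported ℝ ℝ M.smallNodes :=
      Submodule.span_le.2 (by rintro x (rfl | rfl) <;> assumption) (h1 j hj)
    have h4 := geomRep_mem_supported hcomp.compl (cs := cs) g
      (Finsupp.single_mem_supported ℝ (1 : ℝ) (Set.mem_compl hj'))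
    have h5 := Submodule.disjoint_def.1 (disjoint_supported_compl _) _ h3 h4
    have h6 := (isRoot_single (cs := cs) j).geomRep g |>.cosForm_self
    simp [h5] at h6
  have hs' : g⁻¹ * s * g ∈ Subgroup.closure (cs.simple '' J) := h2 s fun x hx ↦ by
    rw [hsu, M.refl_apply, hx u (Submodule.subset_span (by simp)), zero_smul, sub_zero]
  have ht' : g⁻¹ * t * g ∈ Subgroup.closure (cs.simple '' J) := h2 t fun x hx ↦ by
    rw [htv, M.refl_apply, hx v (Submodule.subset_span (by simp)), zero_smul, sub_zero]
  have hsr : cs.IsReflection (g⁻¹ * s * g) := by simpa using hs.conj g⁻¹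
  have htr : cs.IsReflection (g⁻¹ * t * g) := by simpa using ht.conj g⁻¹
  have hcard : J.ncard ≤ 2 := by
    have hli : LinearIndependent ℝ fun j : J ↦ cs.geomRep g (.single (j : B) 1) := by
      have h3 : LinearIndependent ℝ fun j : B ↦ (Finsupp.single j 1 : B →₀ ℝ) := by
        simpa using (Finsupp.basisSingleOne (R := ℝ) (ι := B)).linearIndependent
      have h4 : LinearMap.ker (cs.geomRep g) = ⊥ := by
        refine LinearMap.ker_eq_bot'.2 fun x hx ↦ ?_
        rw [← geomRep_inv_apply cs g x, hx, map_zero]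
      exact (h3.map' _ h4).comp _ Subtype.val_injective
    have h3 : Submodule.span ℝ (Set.range fun j : J ↦ cs.geomRep g (.single (j : B) 1)) ≤
        Submodule.span ℝ (({u, v} : Finset (B →₀ ℝ)) : Set (B →₀ ℝ)) := by
      rw [Submodule.span_le]
      rintro _ ⟨j, rfl⟩
      simpa using h1 j j.2
    have := Fintype.ofFinite J
    have h4 := Submodule.finrank_mono h3
    rw [finrank_span_eq_card hli] at h4
    rw [← Nat.card_coe_set_eq, Nat.card_eq_fintype_card]
    exact h4.trans ((finrank_span_finset_le_card _).trans Finset.card_le_two)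
  obtain ⟨i, j, hi, hJ⟩ : ∃ i j, i ∈ J ∧ J = {i, j} := by
    have hne : J ≠ ∅ := by
      rintro rfl
      rw [Set.image_empty, Subgroup.closure_empty, Subgroup.mem_bot] at hs'
      have := hsr.odd_length
      simp [hs'] at this
    obtain ⟨i, hi⟩ := Set.nonempty_iff_ne_empty.2 hne
    interval_cases h : J.ncard
    · exact absurd ((Set.ncard_eq_zero J.toFinite).1 h) hne
    · obtain ⟨a, rfl⟩ := Set.ncard_eq_one.1 h
      exact ⟨a, a, by simp⟩
    · obtain ⟨a, b, -, rfl⟩ := Set.ncard_eq_two.1 h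
      exact ⟨a, b, by simp⟩
  rw [hJ, Set.image_pair] at hs' ht'
  have hri := cs.isReflection_simple i
  have hrj := cs.isReflection_simple j
  obtain ⟨y, hy⟩ := hsr.eq_zpow_mul_of_mem_closure_pair hri hrj hs'
  obtain ⟨z, hz⟩ := htr.eq_zpow_mul_of_mem_closure_pair hri hrj ht'
  have h5 : M i j ≤ 5 := hsmall i hi j
  have h0 : M i j ≠ 0 := cs.matrix_ne_zero i j
  have hst : g⁻¹ * (s * t) * g = (cs.simple i * cs.simple j) ^ (y - z) := by
    have : g⁻¹ * (s * t) * g = (g⁻¹ * s * g) * (g⁻¹ * t * g)⁻¹ := by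
      rw [htr.inv]; group
    rw [this, hy, hz, zpow_sub]
    group
  have hmod : (cs.simple i * cs.simple j) ^ (y - z) =
      (cs.simple i * cs.simple j) ^ ((y - z).bmod (M i j)) := by
    conv_lhs => rw [← Int.bmod_add_bdiv (y - z) (M i j)]
    rw [zpow_add, zpow_mul, zpow_natCast, cs.simple_mul_simple_pow, one_zpow, mul_one]
  have htr1 : LinearMap.trace ℝ _ (cs.geomRep (s * t)) = Nat.card B - 4 + M.cosForm u v ^ 2 := by
    rw [map_mul, hsu, htv, M.trace_refl_mul_refl hu.cosForm_self hv.cosForm_self]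
  have hk := cosForm_simple_sq (M := M) h0 h5
  set κ := M.cosForm (.single i 1) (.single j 1) with hκ
  have hcase : ∃ r : ℕ, r ≤ 2 ∧ M.cosForm u v ^ 2 =
      (if r = 0 then 2 else if r = 1 then κ else 2 - κ ^ 2) ^ 2 := by
    rw [← trace_geomRep_conj cs g, hst, hmod] at htr1
    obtain ⟨r, hr | hr⟩ := Int.eq_nat_or_neg ((y - z).bmod (M i j))
    all_goals
      have hr2 : r ≤ 2 := by
        have b1 := Int.le_bmod (x := y - z) (Nat.pos_of_ne_zero h0)
        have b2 := Int.bmod_lt (x := y - z) (Nat.pos_of_ne_zero h0)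
        omega
      refine ⟨r, hr2, ?_⟩
      rw [hr] at htr1
    · rw [zpow_natCast, trace_geomRep_simple_mul_simple_pow cs hr2] at htr1
      exact (add_left_cancel htr1).symm
    · have : (cs.simple i * cs.simple j) ^ (-(r : ℤ)) = (cs.simple j * cs.simple i) ^ r := by
        rw [zpow_neg, zpow_natCast, ← inv_pow]
        simp
      rw [this, trace_geomRep_simple_mul_simple_pow cs hr2, M.cosForm_comm] at htr1
      exact (add_left_cancel htr1).symm
  obtain ⟨r, hr, hG⟩ := hcase
  have hφ := Real.goldenRatio_sq
  rw [hG]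
  interval_cases r
  · norm_num
  · simp only [one_ne_zero, ↓reduceIte]
    simp only [Set.mem_insert_iff, Set.mem_singleton_iff] at hk ⊢
    tauto
  · simp only [OfNat.ofNat_ne_zero, OfNat.ofNat_ne_one, ↓reduceIte]
    simp only [Set.mem_insert_iff, Set.mem_singleton_iff] at hk
    rcases hk with h | h | h | h | h <;> rw [h]
    · norm_num
    · norm_num
    · norm_num
    · right; right; right; right; left
      rw [hφ]; ring
    · norm_num

end CoxeterSystem

open scoped goldenRatio

/-- The real number `a + b φ + c √2 + d √2 φ`. -/
noncomputable def goldenSqrt (a b c d : ℤ) : ℝ := a + b * φ + c * √2 + d * (√2 * φ)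

theorem goldenSqrt_mul (a b c d a' b' c' d' : ℤ) :
    goldenSqrt a b c d * goldenSqrt a' b' c' d' =
      goldenSqrt (a * a' + b * b' + 2 * (c * c') + 2 * (d * d'))
        (a * b' + b * a' + b * b' + 2 * (c * d' + d * c' + d * d'))
        (a * c' + c * a' + b * d' + d * b') (a * d' + d * a' + b * c' + c * b' + b * d' + d * b') := by
  have h1 := Real.goldenRatio_sq
  have h2 : √2 ^ 2 = (2 : ℝ) := Real.sq_sqrt (by norm_num)
  simp only [goldenSqrt]
  push_cast
  linear_combination ((b : ℝ) * b' + √2 * (b * d' + d * b') + √2 ^ 2 * (d * d')) * h1 +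
    ((c : ℝ) * c' + (c * d' + d * c') * φ + d * d' * (φ + 1)) * h2

theorem not_isSquare_two_rat : ¬IsSquare (2 : ℚ) := by
  rw [show (2 : ℚ) = (2 : ℕ) by norm_num, Rat.isSquare_natCast_iff]
  rintro ⟨k, hk⟩
  have : k < 4 := by nlinarith
  interval_cases k <;> omega

theorem not_isSquare_ten_rat : ¬IsSquare (10 : ℚ) := by
  rw [show (10 : ℚ) = (10 : ℕ) by norm_num, Rat.isSquare_natCast_iff]
  rintro ⟨k, hk⟩
  have : k < 4 := by nlinarith
  interval_cases k <;> omega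

theorem eq_zero_of_sq_eq_mul_sq {n x y : ℚ} (hn : ¬IsSquare n) (h : x ^ 2 = n * y ^ 2) :
    x = 0 ∧ y = 0 := by
  have hy : y = 0 := by
    by_contra hy
    refine hn ⟨x / y, ?_⟩
    field_simp
    linarith
  subst hy
  simpa using h

theorem linearIndependent_goldenSqrt :
    LinearIndependent ℚ ![(1 : ℝ), φ, √2, √2 * φ] := by
  have h2 : √2 ^ 2 = (2 : ℝ) := Real.sq_sqrt (by norm_num)
  have h5 : √5 ^ 2 = (5 : ℝ) := Real.sq_sqrt (by norm_num)
  have hirr : Irrational √5 := by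
    simpa using Nat.Prime.irrational_sqrt (p := 5) (by norm_num)
  have key (x y : ℚ) (h : (x : ℝ) + y * √5 = 0) : x = 0 ∧ y = 0 := by
    have hy : y = 0 := by
      by_contra hy
      have hy' : (y : ℝ) ≠ 0 := by exact_mod_cast hy
      refine hirr ⟨-x / y, ?_⟩
      push_cast
      field_simp
      linarith
    subst hy
    simpa using h
  rw [Fintype.linearIndependent_iff]
  intro g hg
  simp only [Fin.sum_univ_four, Matrix.cons_val, Rat.smul_def, mul_one] at hg
  set a := g 0
  set b := g 1
  set c := g 2
  set d := g 3
  obtain ⟨p, hp⟩ : ∃ p, p = a + b / 2 := ⟨_, rfl⟩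
  obtain ⟨q, hq⟩ : ∃ q, q = b / 2 := ⟨_, rfl⟩
  obtain ⟨r, hr⟩ : ∃ r, r = c + d / 2 := ⟨_, rfl⟩
  obtain ⟨s, hs⟩ : ∃ s, s = d / 2 := ⟨_, rfl⟩
  have e1 : ((p : ℝ) + q * √5) + √2 * (r + s * √5) = 0 := by
    rw [hp, hq, hr, hs, ← hg, Real.goldenRatio]
    push_cast
    ring
  have e2 : ((p ^ 2 + 5 * q ^ 2 - 2 * r ^ 2 - 10 * s ^ 2 : ℚ) : ℝ) +
      ((2 * p * q - 4 * r * s : ℚ) : ℝ) * √5 = 0 := by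
    push_cast
    linear_combination ((p : ℝ) + q * √5 - √2 * (r + s * √5)) * e1 -
      ((q : ℝ) ^ 2 - 2 * s ^ 2) * h5 + ((r : ℝ) + s * √5) ^ 2 * h2
  obtain ⟨e3, e4⟩ := key _ _ e2
  have e5 : (p ^ 2 - 5 * q ^ 2 - 2 * (r ^ 2 - 5 * s ^ 2)) *
      (p ^ 2 - 5 * q ^ 2 + 2 * (r ^ 2 - 5 * s ^ 2)) = 0 := by
    linear_combination (p ^ 2 + 5 * q ^ 2 + 2 * r ^ 2 + 10 * s ^ 2) * e3 -
      5 * (2 * p * q + 4 * r * s) * e4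
  have e6 : p = 0 ∧ q = 0 ∧ r = 0 ∧ s = 0 := by
    rcases mul_eq_zero.1 e5 with h | h
    · obtain ⟨h3, h4⟩ := eq_zero_of_sq_eq_mul_sq not_isSquare_two_rat (x := p) (y := r)
        (by linarith)
      obtain ⟨h5, h6⟩ := eq_zero_of_sq_eq_mul_sq not_isSquare_two_rat (x := q) (y := s)
        (by linarith)
      exact ⟨h3, h5, h4, h6⟩
    · obtain ⟨h3, h4⟩ := eq_zero_of_sq_eq_mul_sq not_isSquare_ten_rat (x := p) (y := s)
        (by linarith)
      obtain ⟨h5, h6⟩ := eq_zero_of_sq_eq_mul_sq not_isSquare_ten_rat (x := 5 * q) (y := r)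
        (by linarith)
      exact ⟨h3, by linarith, h6, h4⟩
  have hfin : a = 0 ∧ b = 0 ∧ c = 0 ∧ d = 0 := by
    refine ⟨?_, ?_, ?_, ?_⟩ <;> linarith [e6.1, e6.2.1, e6.2.2.1, e6.2.2.2]
  intro i
  fin_cases i
  exacts [hfin.1, hfin.2.1, hfin.2.2.1, hfin.2.2.2]

theorem exists_goldenSqrt_coeff : ∃ τ : ℝ →ₗ[ℚ] ℚ, ∀ a b c d, τ (goldenSqrt a b c d) = a := by
  let bs := Module.Basis.span linearIndependent_goldenSqrt
  obtain ⟨τ, hτ⟩ := LinearMap.exists_extend (bs.coord 0)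
  have h (i : Fin 4) : τ (![(1 : ℝ), φ, √2, √2 * φ] i) = if i = 0 then 1 else 0 := by
    have := LinearMap.congr_fun hτ (bs i)
    rw [LinearMap.comp_apply, Module.Basis.coord_apply, Module.Basis.repr_self,
      Finsupp.single_apply] at this
    simpa [bs, Module.Basis.span_apply] using this
  refine ⟨τ, fun a b c d ↦ ?_⟩
  have e0 := h 0
  have e1 := h 1
  have e2 := h 2
  have e3 := h 3
  simp only [Matrix.cons_val, ↓reduceIte, one_ne_zero, Fin.reduceEq] at e0 e1 e2 e3
  have hz (n : ℤ) (x : ℝ) : τ (n * x) = n * τ x := by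
    rw [← zsmul_eq_mul, map_zsmul, zsmul_eq_mul]
  have h1 : τ (a : ℝ) = a := by
    rw [← mul_one (a : ℝ), hz, e0, mul_one]
  rw [goldenSqrt, map_add, map_add, map_add, hz, hz, hz, e1, e2, e3, h1]
  simp

/-- The possible inner products of two roots whose components have edge labels at most `5`. -/
def IsSmallValue (x : ℝ) : Prop :=
  x ^ 2 ∈ ({0, 1, 2, φ ^ 2, (φ - 1) ^ 2, 4} : Set ℝ)

theorem IsSmallValue.cases {x : ℝ} (hx : IsSmallValue x) :
    x ∈ ({0, 1, -1, √2, -√2, φ, -φ, φ - 1, 1 - φ, 2, -2} : Set ℝ) := by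
  have h2 : √2 ^ 2 = (2 : ℝ) := Real.sq_sqrt (by norm_num)
  simp only [IsSmallValue, Set.mem_insert_iff, Set.mem_singleton_iff] at hx
  simp only [Set.mem_insert_iff, Set.mem_singleton_iff]
  rcases hx with h | h | h | h | h | h
  · simp [pow_eq_zero_iff two_ne_zero |>.1 h]
  · rcases sq_eq_sq_iff_eq_or_eq_neg.1 (h.trans (one_pow 2).symm) with h | h <;> simp [h]
  · rcases sq_eq_sq_iff_eq_or_eq_neg.1 (h.trans h2.symm) with h | h <;> simp [h]
  · rcases sq_eq_sq_iff_eq_or_eq_neg.1 h with h | h <;> simp [h]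
  · rcases sq_eq_sq_iff_eq_or_eq_neg.1 h with h | h <;> simp [h]
  · rcases sq_eq_sq_iff_eq_or_eq_neg.1 (h.trans (show (4 : ℝ) = 2 ^ 2 by norm_num))
      with h | h <;> simp [h]

theorem IsSmallValue.exists_goldenSqrt {x : ℝ} (hx : IsSmallValue x) :
    ∃ a b c d, x = goldenSqrt a b c d := by
  have h := hx.cases
  simp only [Set.mem_insert_iff, Set.mem_singleton_iff] at h
  rcases h with h | h | h | h | h | h | h | h | h | h | h
  exacts [⟨0, 0, 0, 0, by simp [h, goldenSqrt]⟩, ⟨1, 0, 0, 0, by simp [h, goldenSqrt]⟩,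
    ⟨-1, 0, 0, 0, by simp [h, goldenSqrt]⟩, ⟨0, 0, 1, 0, by simp [h, goldenSqrt]⟩,
    ⟨0, 0, -1, 0, by simp [h, goldenSqrt]⟩, ⟨0, 1, 0, 0, by simp [h, goldenSqrt]⟩,
    ⟨0, -1, 0, 0, by simp [h, goldenSqrt]⟩, ⟨-1, 1, 0, 0, by rw [h, goldenSqrt]; push_cast; ring⟩,
    ⟨1, -1, 0, 0, by rw [h, goldenSqrt]; push_cast; ring⟩, ⟨2, 0, 0, 0, by simp [h, goldenSqrt]⟩,
    ⟨-2, 0, 0, 0, by simp [h, goldenSqrt]⟩]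

theorem IsSmallValue.of_coeff_pos {τ : ℝ →ₗ[ℚ] ℚ} (hτ : ∀ a b c d, τ (goldenSqrt a b c d) = a)
    {x : ℝ} (hx : IsSmallValue x) :
    (0 < τ x → x = 1 ∨ x = 2 ∨ x = 1 - φ) ∧ (0 < τ (φ * x) → x = φ ∨ x = φ - 1) ∧
    (0 < τ (√2 * x) → x = √2) ∧ ¬0 < τ (√2 * φ * x) ∧
    (0 < τ (φ * φ * x) → x = 1 ∨ x = 2 ∨ x = φ) ∧ (0 < τ (√2 * φ * φ * x) → x = √2) := by
  have hφ : φ = goldenSqrt 0 1 0 0 := by simp [goldenSqrt]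
  have hs : √2 = goldenSqrt 0 0 1 0 := by simp [goldenSqrt]
  have key (a b c d : ℤ) (h : x = goldenSqrt a b c d) : τ x = a ∧ τ (φ * x) = b ∧
      τ (√2 * x) = 2 * c ∧ τ (√2 * φ * x) = 2 * d ∧ τ (φ * φ * x) = a + b ∧
      τ (√2 * φ * φ * x) = 2 * (c + d) := by
    rw [hφ, hs, h]
    simp only [goldenSqrt_mul, hτ]
    push_cast
    refine ⟨trivial, ?_, ?_, ?_, ?_, ?_⟩ <;> ring
  have h := hx.cases
  simp only [Set.mem_insert_iff, Set.mem_singleton_iff] at h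
  rcases h with h | h | h | h | h | h | h | h | h | h | h
  · obtain ⟨e1, e2, e3, e4, e5, e6⟩ := key 0 0 0 0 (by simp [h, goldenSqrt])
    rw [e1, e2, e3, e4, e5, e6]
    norm_num
  · obtain ⟨e1, e2, e3, e4, e5, e6⟩ := key 1 0 0 0 (by simp [h, goldenSqrt])
    rw [e1, e2, e3, e4, e5, e6]
    norm_num [h]
  · obtain ⟨e1, e2, e3, e4, e5, e6⟩ := key (-1) 0 0 0 (by simp [h, goldenSqrt])
    rw [e1, e2, e3, e4, e5, e6]
    norm_num
  · obtain ⟨e1, e2, e3, e4, e5, e6⟩ := key 0 0 1 0 (by simp [h, goldenSqrt])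
    rw [e1, e2, e3, e4, e5, e6]
    norm_num [h]
  · obtain ⟨e1, e2, e3, e4, e5, e6⟩ := key 0 0 (-1) 0 (by simp [h, goldenSqrt])
    rw [e1, e2, e3, e4, e5, e6]
    norm_num
  · obtain ⟨e1, e2, e3, e4, e5, e6⟩ := key 0 1 0 0 (by simp [h, goldenSqrt])
    rw [e1, e2, e3, e4, e5, e6]
    norm_num [h]
  · obtain ⟨e1, e2, e3, e4, e5, e6⟩ := key 0 (-1) 0 0 (by simp [h, goldenSqrt])
    rw [e1, e2, e3, e4, e5, e6]
    norm_num
  · obtain ⟨e1, e2, e3, e4, e5, e6⟩ := key (-1) 1 0 0 (by rw [h, goldenSqrt]; push_cast; ring)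
    rw [e1, e2, e3, e4, e5, e6]
    norm_num [h]
  · obtain ⟨e1, e2, e3, e4, e5, e6⟩ := key 1 (-1) 0 0 (by rw [h, goldenSqrt]; push_cast; ring)
    rw [e1, e2, e3, e4, e5, e6]
    norm_num [h]
  · obtain ⟨e1, e2, e3, e4, e5, e6⟩ := key 2 0 0 0 (by simp [h, goldenSqrt])
    rw [e1, e2, e3, e4, e5, e6]
    norm_num [h]
  · obtain ⟨e1, e2, e3, e4, e5, e6⟩ := key (-2) 0 0 0 (by simp [h, goldenSqrt])
    rw [e1, e2, e3, e4, e5, e6]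
    norm_num

theorem Multiset.exists_pos_of_map_sum_pos {A : Type*} [AddCommMonoid A] (f : A →+ ℚ)
    {m : Multiset A} (h : 0 < f m.sum) : ∃ b ∈ m, 0 < f b := by
  induction m using Multiset.induction with
  | empty => simp at h
  | cons a m ih =>
    by_cases ha : 0 < f a
    · exact ⟨a, by simp, ha⟩
    · rw [Multiset.sum_cons, f.map_add] at h
      obtain ⟨b, hb, hb'⟩ := ih (by linarith)
      exact ⟨b, Multiset.mem_cons_of_mem hb, hb'⟩

namespace CoxeterMatrix

variable {B : Type*} (M : CoxeterMatrix B)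

/-- A closed subsystem of a root system with inner products as in `IsSmallValue` contains each root
that is, up to a factor `φ`, a sum of its elements scaled by `1`, `φ`, `√2` and `√2 φ`. -/
theorem mem_of_eq_multiset_sum {Φ Ψ : Set (B →₀ ℝ)} (hself : ∀ u ∈ Φ, M.cosForm u u = 2)
    (hΦ : ∀ u ∈ Φ, ∀ v ∈ Φ, M.refl u v ∈ Φ)
    (htwo : ∀ u ∈ Φ, ∀ v ∈ Φ, M.cosForm u v = 2 → u = v)
    (hsmall : ∀ u ∈ Φ, ∀ v ∈ Φ, IsSmallValue (M.cosForm u v)) (hsub : Ψ ⊆ Φ)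
    (hΨ : ∀ u ∈ Ψ, ∀ v ∈ Ψ, M.refl u v ∈ Ψ) (m : Multiset (B →₀ ℝ))
    (hm : ∀ x ∈ m, ∃ e ∈ ({1, φ, √2, √2 * φ} : Set ℝ), ∃ c ∈ Ψ, x = e • c)
    {u : B →₀ ℝ} (hu : u ∈ Φ) : (u = m.sum → u ∈ Ψ) ∧ (φ • u = m.sum → u ∈ Ψ) := by
  obtain ⟨τ, hτ⟩ := exists_goldenSqrt_coeff
  have hφ := Real.goldenRatio_sq
  have neg_mem (S : Set (B →₀ ℝ)) (hS : S ⊆ Φ) (h : ∀ u ∈ S, ∀ v ∈ S, M.refl u v ∈ S)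
      (v : B →₀ ℝ) (hv : v ∈ S) : -v ∈ S := by
    rw [← M.refl_self (hself v (hS hv))]
    exact h v hv v hv
  induction hn : m.card generalizing m u with
  | zero =>
    rw [Multiset.card_eq_zero] at hn
    subst hn
    have h0 : u ≠ 0 := by
      rintro rfl
      simpa using hself _ hu
    constructor
    · intro h; exact absurd h (by simpa using h0)
    · intro h; exact absurd h (smul_ne_zero Real.goldenRatio_ne_zero h0)
  | succ n ih =>
    have hu2 := hself u hu
    have step (b : B →₀ ℝ) (hb : b ∈ m) {v : B →₀ ℝ} (hv : v ∈ Φ)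
        (h : v + b = m.sum ∨ φ • v + b = m.sum) : v ∈ Ψ := by
      obtain ⟨m', rfl⟩ := Multiset.exists_cons_of_mem hb
      rw [Multiset.sum_cons, add_comm b] at h
      have := ih m' (fun x hx ↦ hm x (Multiset.mem_cons_of_mem hx)) hv (by simpa using hn)
      rcases h with h | h
      · exact this.1 (add_right_cancel h)
      · exact this.2 (add_right_cancel h)
    constructor
    · intro hsum
      obtain ⟨b, hb, hpos⟩ := Multiset.exists_pos_of_map_sum_pos
        (τ.toAddMonoidHom.comp (M.cosForm u).toAddMonoidHom) (m := m) (by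
          rw [← hsum]
          have := hτ 2 0 0 0
          simp only [goldenSqrt] at this
          norm_num at this
          simp [hu2, this])
      obtain ⟨e, he, c, hc, rfl⟩ := hm b hb
      have hc2 := hself c (hsub hc)
      have hcu := M.cosForm_comm c u
      obtain ⟨p1, p2, p3, p4, -, -⟩ := (hsmall u hu c (hsub hc)).of_coeff_pos hτ
      simp only [Set.mem_insert_iff, Set.mem_singleton_iff] at he
      simp only [AddMonoidHom.comp_apply, LinearMap.toAddMonoidHom_coe, map_smul,
        smul_eq_mul] at hpos
      have key (h : M.cosForm u c = e) : u ∈ Ψ := by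
        rw [← M.refl_refl hc2 u]
        refine hΨ c hc _ (step _ hb (hΦ c (hsub hc) u hu) (.inl ?_))
        rw [← hsum, M.refl_apply, hcu, h]
        module
      rcases he with rfl | rfl | rfl | rfl
      · rw [one_mul] at hpos
        rcases p1 hpos with h | h | h
        · exact key h
        · exact htwo u hu c (hsub hc) h ▸ hc
        · obtain ⟨v, hv⟩ : ∃ v, v = M.refl c (M.refl u c) := ⟨_, rfl⟩
          have hv' : v = (φ - 1) • u - (φ - 1) • c := by
            rw [hv]
            simp only [M.refl_apply, map_sub, map_smul, hcu, h, hc2, smul_eq_mul]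
            match_scalars <;> grind
          have hvΦ : v ∈ Φ := hv ▸ hΦ c (hsub hc) _ (hΦ u hu c (hsub hc))
          have hvΨ := step _ hb hvΦ (.inr (by rw [← hsum, hv']; match_scalars <;> grind))
          have hvc : M.cosForm v c = -φ := by
            simp only [hv', map_sub, map_smul, LinearMap.sub_apply, LinearMap.smul_apply, h, hc2,
              smul_eq_mul]
            grind
          have hru : u = M.refl v c := by
            rw [M.refl_apply, hvc]
            rw [hv']
            match_scalars <;> grind
          exact hru ▸ hΨ v hvΨ c hc
      · rcases p2 hpos with h | h
        · exact key h
        · obtain ⟨v, hv⟩ : ∃ v, v = -M.refl u c := ⟨_, rfl⟩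
          have hv' : v = (φ - 1) • u - c := by
            rw [hv]
            simp only [M.refl_apply, h]
            match_scalars <;> grind
          have hvΦ : v ∈ Φ := hv ▸ neg_mem Φ subset_rfl hΦ _ (hΦ u hu c (hsub hc))
          have hvΨ := step _ hb hvΦ (.inr (by rw [← hsum, hv']; match_scalars <;> grind))
          have hvc : M.cosForm v c = -φ := by
            simp only [hv', map_sub, map_smul, LinearMap.sub_apply, LinearMap.smul_apply, h, hc2,
              smul_eq_mul]
            grind
          have hru : u = M.refl c (M.refl v c) := by
            simp only [M.refl_apply, map_sub, map_smul, M.cosForm_comm c v, hvc, hc2, smul_eq_mul]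
            rw [hv']
            match_scalars <;> grind
          exact hru ▸ hΨ c hc _ (hΨ v hvΨ c hc)
      · exact key (p3 hpos)
      · exact absurd hpos p4
    · intro hsum
      obtain ⟨b, hb, hpos⟩ := Multiset.exists_pos_of_map_sum_pos
        (τ.toAddMonoidHom.comp (M.cosForm (φ • u)).toAddMonoidHom) (m := m) (by
          rw [← hsum]
          have := hτ 2 2 0 0
          simp only [goldenSqrt] at this
          norm_num at this
          have h2 : φ * (φ * 2) = 2 + 2 * φ := by linear_combination 2 * hφ
          simp only [AddMonoidHom.comp_apply, LinearMap.toAddMonoidHom_coe, map_smul,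
            LinearMap.smul_apply, smul_eq_mul, hu2, h2, map_add, this]
          norm_num)
      obtain ⟨e, he, c, hc, rfl⟩ := hm b hb
      have hc2 := hself c (hsub hc)
      have hcu := M.cosForm_comm c u
      obtain ⟨-, p2, -, p4, p5, p6⟩ := (hsmall u hu c (hsub hc)).of_coeff_pos hτ
      simp only [Set.mem_insert_iff, Set.mem_singleton_iff] at he
      simp only [AddMonoidHom.comp_apply, LinearMap.toAddMonoidHom_coe, map_smul,
        smul_eq_mul, LinearMap.smul_apply, ← mul_assoc] at hpos
      have key (h : φ * M.cosForm u c = e) : u ∈ Ψ := by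
        rw [← M.refl_refl hc2 u]
        refine hΨ c hc _ (step _ hb (hΦ c (hsub hc) u hu) (.inr ?_))
        rw [← hsum, M.refl_apply, hcu, ← h]
        module
      rcases he with rfl | rfl | rfl | rfl
      · rw [one_mul] at hpos
        rcases p2 hpos with h | h
        · obtain ⟨v, hv⟩ : ∃ v, v = -M.refl u c := ⟨_, rfl⟩
          have hv' : v = φ • u - c := by
            rw [hv]
            simp only [M.refl_apply, h]
            match_scalars <;> grind
          have hvΦ : v ∈ Φ := hv ▸ neg_mem Φ subset_rfl hΦ _ (hΦ u hu c (hsub hc))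
          have hvΨ := step _ hb hvΦ (.inl (by rw [← hsum, hv']; match_scalars <;> grind))
          have hvc : M.cosForm v c = φ - 1 := by
            simp only [hv', map_sub, map_smul, LinearMap.sub_apply, LinearMap.smul_apply, h, hc2,
              smul_eq_mul]
            grind
          have hru : u = -M.refl c (M.refl v c) := by
            simp only [M.refl_apply, map_sub, map_smul, M.cosForm_comm c v, hvc, hc2, smul_eq_mul]
            rw [hv']
            match_scalars <;> grind
          exact hru ▸ neg_mem Ψ hsub hΨ _ (hΨ c hc _ (hΨ v hvΨ c hc))
        · exact key (by rw [h]; linear_combination hφ)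
      · rcases p5 hpos with h | h | h
        · exact key (by rw [h, mul_one])
        · exact htwo u hu c (hsub hc) h ▸ hc
        · obtain ⟨v, hv⟩ : ∃ v, v = -M.refl c (M.refl u c) := ⟨_, rfl⟩
          have hv' : v = φ • u - φ • c := by
            rw [hv]
            simp only [M.refl_apply, map_sub, map_smul, hcu, h, hc2, smul_eq_mul]
            match_scalars <;> grind
          have hvΦ : v ∈ Φ := hv ▸ neg_mem Φ subset_rfl hΦ _ (hΦ c (hsub hc) _ (hΦ u hu c (hsub hc)))
          have hvΨ := step _ hb hvΦ (.inl (by rw [← hsum, hv']; match_scalars <;> grind))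
          have hvc : M.cosForm v c = 1 - φ := by
            simp only [hv', map_sub, map_smul, LinearMap.sub_apply, LinearMap.smul_apply, h, hc2,
              smul_eq_mul]
            grind
          have hru : u = M.refl v c := by
            rw [M.refl_apply, hvc]
            rw [hv']
            match_scalars <;> grind
          exact hru ▸ hΨ v hvΨ c hc
      · exact absurd hpos p4
      · exact key (by rw [p6 hpos, mul_comm])

end CoxeterMatrix

/-- The ring `ℤ[φ, √2]`. -/
noncomputable def goldenSqrtRing : Subring ℝ where
  carrier := {x | ∃ a b c d, x = goldenSqrt a b c d}
  mul_mem' := by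
    rintro _ _ ⟨a, b, c, d, rfl⟩ ⟨a', b', c', d', rfl⟩
    exact ⟨_, _, _, _, goldenSqrt_mul ..⟩
  add_mem' := by
    rintro _ _ ⟨a, b, c, d, rfl⟩ ⟨a', b', c', d', rfl⟩
    exact ⟨a + a', b + b', c + c', d + d', by simp only [goldenSqrt]; push_cast; ring⟩
  one_mem' := ⟨1, 0, 0, 0, by simp [goldenSqrt]⟩
  zero_mem' := ⟨0, 0, 0, 0, by simp [goldenSqrt]⟩
  neg_mem' := by
    rintro _ ⟨a, b, c, d, rfl⟩
    exact ⟨-a, -b, -c, -d, by simp only [goldenSqrt]; push_cast; ring⟩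

theorem IsSmallValue.mem_goldenSqrtRing {x : ℝ} (hx : IsSmallValue x) : x ∈ goldenSqrtRing :=
  hx.exists_goldenSqrt

section RingSpan

variable {V : Type*} [AddCommGroup V] [Module ℝ V] (R : Subring ℝ)

/-- The span of a list of vectors over a subring of the reals. -/
def ringSpan (l : List V) : Submodule R V := Submodule.span R {b | b ∈ l}

variable {R}

theorem mem_ringSpan {l : List V} {b : V} (hb : b ∈ l) : b ∈ ringSpan R l :=
  Submodule.subset_span hb

theorem ringSpan_le {l : List V} {p : Submodule R V} : ringSpan R l ≤ p ↔ ∀ b ∈ l, b ∈ p :=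
  Submodule.span_le

theorem smul_mem_ringSpan {l : List V} {a : ℝ} (ha : a ∈ R) {x : V} (hx : x ∈ ringSpan R l) :
    a • x ∈ ringSpan R l :=
  (ringSpan R l).smul_mem ⟨a, ha⟩ hx

theorem ringSpan_append (l₁ l₂ : List V) :
    ringSpan R (l₁ ++ l₂) = ringSpan R l₁ ⊔ ringSpan R l₂ := by
  rw [ringSpan, ringSpan, ringSpan, ← Submodule.span_union]
  congr 1
  ext; simp

theorem mem_ringSpan_cons {b x : V} {l : List V} :
    x ∈ ringSpan R (b :: l) ↔ ∃ a ∈ R, ∃ z ∈ ringSpan R l, x = a • b + z := by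
  rw [← List.singleton_append, ringSpan_append, Submodule.mem_sup]
  have hb : ringSpan R [b] = Submodule.span R {b} := by simp [ringSpan]
  simp only [hb, Submodule.mem_span_singleton]
  constructor
  · rintro ⟨_, ⟨a, rfl⟩, z, hz, rfl⟩
    exact ⟨a, a.2, z, hz, rfl⟩
  · rintro ⟨a, ha, z, hz, rfl⟩
    exact ⟨_, ⟨⟨a, ha⟩, rfl⟩, z, hz, rfl⟩

theorem mem_listSpan_of_mem_ringSpan {l : List V} {x : V} (hx : x ∈ ringSpan R l) :
    x ∈ listSpan l := by
  have : ringSpan R l ≤ (listSpan l).restrictScalars R := ringSpan_le.2 fun b hb ↦ mem_listSpan hb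
  exact this hx

end RingSpan

theorem exists_multiset_of_mem_ringSpan {V : Type*} [AddCommGroup V] [Module ℝ V] {l : List V}
    {S : Set V} (hS : ∀ b ∈ S, -b ∈ S) (hl : ∀ b ∈ l, b ∈ S) {x : V}
    (hx : x ∈ ringSpan goldenSqrtRing l) : ∃ m : Multiset V,
      (∀ y ∈ m, ∃ e ∈ ({1, φ, √2, √2 * φ} : Set ℝ), ∃ c ∈ S, y = e • c) ∧ x = m.sum := by
  let E : Set V := {y | ∃ e ∈ ({1, φ, √2, √2 * φ} : Set ℝ), ∃ c ∈ S, y = e • c}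
  have key (n : ℤ) {e : ℝ} (he : e ∈ ({1, φ, √2, √2 * φ} : Set ℝ)) {b : V} (hb : b ∈ S) :
      ((n : ℝ) * e) • b ∈ AddSubmonoid.closure E := by
    have h1 (n : ℕ) {b : V} (hb : b ∈ S) : ((n : ℝ) * e) • b ∈ AddSubmonoid.closure E := by
      rw [mul_smul, Nat.cast_smul_eq_nsmul]
      exact nsmul_mem (AddSubmonoid.subset_closure (show e • b ∈ E from ⟨e, he, b, hb, rfl⟩)) n
    obtain ⟨k, rfl | rfl⟩ := n.eq_nat_or_neg
    · simpa using h1 k hb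
    · have := h1 k (hS b hb)
      rw [smul_neg, ← neg_smul, ← neg_mul] at this
      simpa using this
  have hmem : x ∈ AddSubmonoid.closure E := by
    induction hx using Submodule.closure_induction with
    | zero => exact zero_mem _
    | add x y _ _ hx hy => exact add_mem hx hy
    | smul_mem r b hb =>
      obtain ⟨r, a, b', c, d, rfl⟩ := r
      have hbS := hl b hb
      have : goldenSqrt a b' c d • b =
          (a * 1 : ℝ) • b + (b' * φ) • b + (c * √2) • b + (d * (√2 * φ)) • b := by
        rw [goldenSqrt, mul_one]
        module
      change goldenSqrt a b' c d • b ∈ _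
      rw [this]
      exact add_mem (add_mem (add_mem (key a (by simp) hbS) (key b' (by simp) hbS))
        (key c (by simp) hbS)) (key d (by simp) hbS)
  obtain ⟨m, hm, rfl⟩ := AddSubmonoid.exists_multiset_of_mem_closure hmem
  exact ⟨m, hm, rfl⟩

namespace CoxeterMatrix

variable {B : Type*} (M : CoxeterMatrix B) {R : Subring ℝ}

theorem cosForm_mem_of_mem_ringSpan {l : List (B →₀ ℝ)} {v : B →₀ ℝ}
    (h : ∀ b ∈ l, M.cosForm b v ∈ R) {x : B →₀ ℝ} (hx : x ∈ ringSpan R l) :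
    M.cosForm x v ∈ R := by
  induction hx using Submodule.span_induction with
  | mem b hb => exact h b hb
  | zero => simp
  | add x y _ _ hx hy => simpa using add_mem hx hy
  | smul a x _ hx => simpa [Subring.smul_def] using mul_mem a.2 hx

theorem sub_reflProd_mem_ringSpan {l : List (B →₀ ℝ)}
    (hl : ∀ b ∈ l, ∀ c ∈ l, M.cosForm b c ∈ R) {v : B →₀ ℝ} (hv : ∀ b ∈ l, M.cosForm b v ∈ R) :
    v - M.reflProd l v ∈ ringSpan R l := by
  induction l with
  | nil => simp [reflProd_nil]
  | cons b l ih =>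
    have h1 := ih (fun c hc d hd ↦ hl c (by simp [hc]) d (by simp [hd]))
      fun c hc ↦ hv c (by simp [hc])
    have h2 : M.cosForm b (v - M.reflProd l v) ∈ R := by
      rw [M.cosForm_comm]
      exact M.cosForm_mem_of_mem_ringSpan (fun c hc ↦ hl c (by simp [hc]) b (by simp)) h1
    refine mem_ringSpan_cons.2 ⟨M.cosForm b (M.reflProd l v), ?_, _, h1, ?_⟩
    · simpa using sub_mem (hv b (by simp)) h2
    · rw [reflProd_cons, Module.End.mul_apply, refl_apply]
      module

theorem cosForm_mem_of_sub_reflProd_mem_ringSpan {l : List (B →₀ ℝ)} (hind : ListIndep l)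
    (hl : ∀ b ∈ l, ∀ c ∈ l, M.cosForm b c ∈ R) {v : B →₀ ℝ}
    (hv : v - M.reflProd l v ∈ ringSpan R l) : ∀ b ∈ l, M.cosForm b v ∈ R := by
  induction l with
  | nil => simp
  | cons b l ih =>
    obtain ⟨hb, hind⟩ := listIndep_cons.1 hind
    obtain ⟨a, ha, z, hz, h⟩ := mem_ringSpan_cons.1 hv
    rw [reflProd_cons, Module.End.mul_apply, refl_apply] at h
    have h1 : (M.cosForm b (M.reflProd l v) - a) • b = z - (v - M.reflProd l v) := by
      rw [← sub_eq_of_eq_add' h]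
      module
    have h2 : M.cosForm b (M.reflProd l v) = a := by
      by_contra hne
      refine hb (((listSpan l).smul_mem_iff (sub_ne_zero.2 hne)).1 ?_)
      rw [h1]
      exact sub_mem (mem_listSpan_of_mem_ringSpan hz) (M.sub_reflProd_mem l v)
    have h3 : v - M.reflProd l v = z := by
      rw [h2, sub_self, zero_smul, eq_comm, sub_eq_zero] at h1
      exact h1.symm
    have h4 := ih hind (fun c hc d hd ↦ hl c (by simp [hc]) d (by simp [hd])) (h3 ▸ hz)
    refine List.forall_mem_cons.2 ⟨?_, h4⟩
    have h5 : M.cosForm b z ∈ R := by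
      rw [M.cosForm_comm]
      exact M.cosForm_mem_of_mem_ringSpan (fun c hc ↦ hl c (by simp [hc]) b (by simp)) hz
    have h6 : M.cosForm b v = a + M.cosForm b z := by
      rw [← h3, map_sub, h2]
      ring
    rw [h6]
    exact add_mem ha h5

end CoxeterMatrix

namespace CoxeterSystem

open CoxeterMatrix

variable {B W : Type*} [Group W] {M : CoxeterMatrix B} {cs : CoxeterSystem M W}

theorem mem_supported_of_mem_map_restrict {J : Set B} {l : List W} {b : B →₀ ℝ}
    (hb : b ∈ (cs.restrict J l).map cs.rootOf) : b ∈ Finsupp.supported ℝ ℝ J := by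
  rw [map_rootOf_restrict] at hb
  exact (CoxeterMatrix.mem_restrict.1 hb).2

theorem isReflection_of_mem_restrict {J : Set B} {l : List W} (hl : ∀ t ∈ l, cs.IsReflection t) :
    ∀ t ∈ cs.restrict J l, cs.IsReflection t :=
  fun t ht ↦ hl t ((cs.mem_restrict).1 ht).1

theorem isRoot_of_mem_map_restrict {J : Set B} {l : List W} (hl : ∀ t ∈ l, cs.IsReflection t)
    {b : B →₀ ℝ} (hb : b ∈ (cs.restrict J l).map cs.rootOf) : cs.IsRoot b :=
  cs.isRoot_of_mem_map_rootOf (isReflection_of_mem_restrict hl) hb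

theorem listIndep_map_restrict {J : Set B} {l : List W} (h : ListIndep (l.map cs.rootOf)) :
    ListIndep ((cs.restrict J l).map cs.rootOf) := by
  rw [map_rootOf_restrict]
  exact h.sublist (restrict_sublist _ _)

theorem geomRep_mem_ringSpan {J : Set B} (hJ : M.IsComponents J) {R : Subring ℝ} {l : List W}
    (hl : ∀ t ∈ l, cs.IsReflection t)
    (hR : ∀ b ∈ (cs.restrict J l).map cs.rootOf, ∀ c ∈ (cs.restrict J l).map cs.rootOf,
      M.cosForm b c ∈ R) {g : W} (hg : g ∈ Subgroup.closure {t | t ∈ l}) :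
    ∀ x ∈ ringSpan R ((cs.restrict J l).map cs.rootOf),
      cs.geomRep g x ∈ ringSpan R ((cs.restrict J l).map cs.rootOf) ∧
      cs.geomRep g⁻¹ x ∈ ringSpan R ((cs.restrict J l).map cs.rootOf) := by
  induction hg using Subgroup.closure_induction with
  | mem t ht =>
    intro x hx
    have htr := hl t ht
    rw [htr.inv, and_self, htr.geomRep_eq]
    rcases htr.isRoot_rootOf.mem_supported_or hJ with h | h
    · have hmem : cs.rootOf t ∈ (cs.restrict J l).map cs.rootOf :=
        List.mem_map_of_mem ((cs.mem_restrict).2 ⟨ht, h⟩)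
      rw [M.refl_apply, M.cosForm_comm]
      exact sub_mem hx (smul_mem_ringSpan
        (M.cosForm_mem_of_mem_ringSpan (fun c hc ↦ hR c hc _ hmem) hx) (mem_ringSpan hmem))
    · have hxJ : x ∈ Finsupp.supported ℝ ℝ J :=
        listSpan_le.2 (fun b hb ↦ mem_supported_of_mem_map_restrict hb)
          (mem_listSpan_of_mem_ringSpan hx)
      rwa [hJ.refl_apply_eq h hxJ]
  | one => simp
  | mul a b _ _ iha ihb =>
    intro x hx
    rw [mul_inv_rev, map_mul, map_mul]
    exact ⟨(iha _ (ihb x hx).1).1, (ihb _ (iha x hx).2).2⟩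
  | inv a _ iha =>
    intro x hx
    rw [inv_inv]
    exact (iha x hx).symm

theorem IsRoot.mem_ringSpan {J : Set B} (hJ : M.IsComponents J) {R : Subring ℝ} {l : List W}
    (hl : ∀ t ∈ l, cs.IsReflection t) (htop : Subgroup.closure {t | t ∈ l} = ⊤)
    (hR : ∀ b ∈ (cs.restrict J l).map cs.rootOf, ∀ c ∈ (cs.restrict J l).map cs.rootOf,
      M.cosForm b c ∈ R) {u : B →₀ ℝ} (hu : cs.IsRoot u) (huJ : u ∈ Finsupp.supported ℝ ℝ J) :
    u ∈ ringSpan R ((cs.restrict J l).map cs.rootOf) := by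
  obtain ⟨_, hb, g, hg⟩ := hu.exists_eq_or_eq_neg hl htop
  obtain ⟨t, ht, rfl⟩ := List.mem_map.1 hb
  have hmem : cs.geomRep g (cs.rootOf t) ∈ Finsupp.supported ℝ ℝ J := by
    rcases hg with rfl | rfl
    · exact huJ
    · exact neg_mem_iff.1 huJ
  have htJ : cs.rootOf t ∈ Finsupp.supported ℝ ℝ J := by
    simpa [geomRep_inv_apply] using geomRep_mem_supported (cs := cs) hJ g⁻¹ hmem
  have key := (geomRep_mem_ringSpan hJ hl hR (htop ▸ Subgroup.mem_top g) (cs.rootOf t)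
    (_root_.mem_ringSpan (List.mem_map_of_mem ((cs.mem_restrict).2 ⟨ht, htJ⟩)))).1
  rcases hg with rfl | rfl
  · exact key
  · exact neg_mem key

variable [Finite W]

theorem ringSpan_restrict_le {J : Set B} (hJ : M.IsComponents J) {R : Subring ℝ} {l l' : List W}
    (hl : ∀ t ∈ l, cs.IsReflection t) (hl' : ∀ t ∈ l', cs.IsReflection t)
    (htop : Subgroup.closure {t | t ∈ l} = ⊤) (hind : ListIndep (l.map cs.rootOf))
    (hprod : l'.prod = l.prod)
    (hR : ∀ u v, cs.IsRoot u → cs.IsRoot v → u ∈ Finsupp.supported ℝ ℝ J →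
      v ∈ Finsupp.supported ℝ ℝ J → M.cosForm u v ∈ R) :
    ringSpan R ((cs.restrict J l).map cs.rootOf) ≤
      ringSpan R ((cs.restrict J l').map cs.rootOf) := by
  have hgram (l : List W) (hl : ∀ t ∈ l, cs.IsReflection t) :
      ∀ b ∈ (cs.restrict J l).map cs.rootOf, ∀ c ∈ (cs.restrict J l).map cs.rootOf,
        M.cosForm b c ∈ R := fun b hb c hc ↦
    hR b c (isRoot_of_mem_map_restrict hl hb) (isRoot_of_mem_map_restrict hl hc)
      (mem_supported_of_mem_map_restrict hb) (mem_supported_of_mem_map_restrict hc)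
  have hindr := listIndep_map_restrict (J := J) hind
  refine ringSpan_le.2 fun b hb ↦ ?_
  obtain ⟨v, hv⟩ : b ∈ LinearMap.range (1 - M.reflProd ((cs.restrict J l).map cs.rootOf)) := by
    rw [cs.range_one_sub_reflProd hindr]
    exact mem_listSpan hb
  rw [LinearMap.sub_apply, Module.End.one_apply] at hv
  have h1 := M.cosForm_mem_of_sub_reflProd_mem_ringSpan (R := R) hindr (hgram l hl)
    (hv ▸ mem_ringSpan hb)
  have h2 : M.reflProd ((cs.restrict J l).map cs.rootOf) =
      M.reflProd ((cs.restrict J l').map cs.rootOf) := by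
    rw [← cs.geomRep_list_prod (isReflection_of_mem_restrict hl),
      ← cs.geomRep_list_prod (isReflection_of_mem_restrict hl'),
      restrict_prod_congr hJ hl' hl hprod]
  rw [← hv, h2]
  refine M.sub_reflProd_mem_ringSpan (hgram l' hl') fun c hc ↦ ?_
  exact M.cosForm_mem_of_mem_ringSpan h1 ((isRoot_of_mem_map_restrict hl' hc).mem_ringSpan hJ hl
    htop (hgram l hl) (mem_supported_of_mem_map_restrict hc))

theorem mem_of_mem_ringSpan {l : List W} (hl : ∀ t ∈ l, cs.IsReflection t)
    {u : B →₀ ℝ} (hu : cs.IsRoot u) (huJ : u ∈ Finsupp.supported ℝ ℝ M.smallNodes)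
    (h : u ∈ ringSpan goldenSqrtRing ((cs.restrict M.smallNodes l).map cs.rootOf)) :
    ∃ t ∈ Subgroup.closure {t | t ∈ l}, cs.geomRep t = M.refl u := by
  let Φ : Set (B →₀ ℝ) := {u | cs.IsRoot u ∧ u ∈ Finsupp.supported ℝ ℝ M.smallNodes}
  let Ψ : Set (B →₀ ℝ) := {u | u ∈ Φ ∧ ∃ t ∈ Subgroup.closure {t | t ∈ l}, cs.geomRep t = M.refl u}
  have hΦ (u : B →₀ ℝ) (hu : u ∈ Φ) (v : B →₀ ℝ) (hv : v ∈ Φ) : M.refl u v ∈ Φ := by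
    refine ⟨hu.1.refl hv.1, ?_⟩
    rw [M.refl_apply]
    exact sub_mem hv.2 (Submodule.smul_mem _ _ hu.2)
  have hΨ (u : B →₀ ℝ) (hu : u ∈ Ψ) (v : B →₀ ℝ) (hv : v ∈ Ψ) : M.refl u v ∈ Ψ := by
    refine ⟨hΦ u hu.1 v hv.1, ?_⟩
    obtain ⟨⟨hur, -⟩, a, ha, hau⟩ := hu
    obtain ⟨-, b, hb, hbv⟩ := hv
    exact ⟨a * b * a⁻¹, mul_mem (mul_mem ha hb) (inv_mem ha), by
      rw [map_mul, map_mul, hbv, geomRep_conj_refl, hau]⟩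
  have hneg (b : B →₀ ℝ) (hb : b ∈ Ψ) : -b ∈ Ψ := by
    rw [← M.refl_self hb.1.1.cosForm_self]
    exact hΨ b hb b hb
  have hlΨ (b : B →₀ ℝ) (hb : b ∈ (cs.restrict M.smallNodes l).map cs.rootOf) : b ∈ Ψ := by
    refine ⟨⟨isRoot_of_mem_map_restrict hl hb, mem_supported_of_mem_map_restrict hb⟩, ?_⟩
    obtain ⟨t, ht, rfl⟩ := List.mem_map.1 hb
    have htl := ((cs.mem_restrict).1 ht).1
    exact ⟨t, Subgroup.subset_closure htl, (hl t htl).geomRep_eq⟩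
  obtain ⟨m, hm, hum⟩ := exists_multiset_of_mem_ringSpan hneg hlΨ h
  exact ((M.mem_of_eq_multiset_sum (fun u hu ↦ hu.1.cosForm_self) hΦ
    (fun u hu v hv ↦ cs.eq_of_cosForm_eq_two hu.1.cosForm_self hv.1.cosForm_self)
    (fun u hu v hv ↦ hu.1.cosForm_sq_mem hv.1 hu.2 hv.2) (fun u hu ↦ hu.1) hΨ m hm ⟨hu, huJ⟩).1
    hum).2

/-- In a reduced factorization of a quasi-Coxeter element, each reflection whose root lies in the
span of the roots of an initial segment belongs to the subgroup generated by that segment. -/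
theorem IsReflection.mem_closure_of_mem_listSpan {l₁ l₂ l : List W}
    (hl₁ : ∀ t ∈ l₁, cs.IsReflection t) (hl₂ : ∀ t ∈ l₂, cs.IsReflection t)
    (hl : ∀ t ∈ l, cs.IsReflection t) (htop : Subgroup.closure {t | t ∈ l} = ⊤)
    (hind : ListIndep (l.map cs.rootOf)) (hind' : ListIndep ((l₁ ++ l₂).map cs.rootOf))
    (hprod : (l₁ ++ l₂).prod = l.prod) {t : W} (ht : cs.IsReflection t)
    (htl : cs.rootOf t ∈ listSpan (l₁.map cs.rootOf)) : t ∈ Subgroup.closure {t | t ∈ l₁} := by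
  have hJ := cs.isComponents_smallNodes
  by_cases htJ : cs.rootOf t ∈ Finsupp.supported ℝ ℝ M.smallNodes
  · have hl₁₂ : ∀ t ∈ l₁ ++ l₂, cs.IsReflection t := fun t ht ↦
      (List.mem_append.1 ht).elim (hl₁ t) (hl₂ t)
    have hR (u v : B →₀ ℝ) (hu : cs.IsRoot u) (hv : cs.IsRoot v)
        (huJ : u ∈ Finsupp.supported ℝ ℝ M.smallNodes)
        (hvJ : v ∈ Finsupp.supported ℝ ℝ M.smallNodes) : M.cosForm u v ∈ goldenSqrtRing :=
      IsSmallValue.mem_goldenSqrtRing (hu.cosForm_sq_mem hv huJ hvJ)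
    have h1 := ringSpan_restrict_le hJ hl hl₁₂ htop hind hprod hR
      (ht.isRoot_rootOf.mem_ringSpan hJ hl htop (fun b hb c hc ↦
        hR b c (isRoot_of_mem_map_restrict hl hb) (isRoot_of_mem_map_restrict hl hc)
          (mem_supported_of_mem_map_restrict hb) (mem_supported_of_mem_map_restrict hc)) htJ)
    rw [restrict_append, List.map_append, ringSpan_append, Submodule.mem_sup] at h1
    obtain ⟨x, hx, y, hy, hxy⟩ := h1
    rw [List.map_append, listIndep_append] at hind'
    have hle (l : List W) : listSpan ((cs.restrict M.smallNodes l).map cs.rootOf) ≤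
        listSpan (l.map cs.rootOf) := by
      rw [map_rootOf_restrict]
      exact listSpan_mono_of_subset (restrict_sublist _ _).subset
    have hy0 : y = 0 := by
      refine Submodule.disjoint_def.1 hind'.2.2 y ?_ (hle _ (mem_listSpan_of_mem_ringSpan hy))
      rw [← add_sub_cancel_left x y, hxy]
      exact sub_mem htl (hle _ (mem_listSpan_of_mem_ringSpan hx))
    rw [hy0, add_zero] at hxy
    obtain ⟨s, hs, hst⟩ := mem_of_mem_ringSpan hl₁ ht.isRoot_rootOf htJ (hxy ▸ hx)
    rwa [cs.geomRep_injective (ht.geomRep_eq.trans hst.symm)]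
  · obtain ⟨w, i, hi⟩ := ht.isRoot_rootOf
    have hi' : i ∉ M.smallNodes := fun h ↦ htJ
      (hi ▸ geomRep_mem_supported hJ w (Finsupp.single_mem_supported ℝ _ h))
    obtain ⟨j, hj⟩ : ∃ j, 6 ≤ M i j := by
      by_contra! h
      exact hi' fun j ↦ Nat.lt_succ_iff.1 (h j)
    have hij : i ≠ j := by
      rintro rfl
      have h : M.M i i = 1 := M.diagonal i
      change 6 ≤ M.M i i at hj
      omega
    have hJ' := cs.isComponents_pair hj
    exact ht.mem_closure_of_isComponents_pair hij hJ' hl₁ hl₂ hl htop hind hind' hprod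
      (hi ▸ geomRep_mem_supported hJ' w (Finsupp.single_mem_supported ℝ _ (by simp))) htl

omit [Finite W] in
theorem exists_mem_redT (w : W) : ∃ l, l ∈ RedT cs w := by
  have hne : {k | ∃ l : List W, l.length = k ∧ (∀ t ∈ l, cs.IsReflection t) ∧
      l.prod = w}.Nonempty := by
    have h : ∃ l : List W, (∀ t ∈ l, cs.IsReflection t) ∧ l.prod = w := by
      obtain ⟨l, -, rfl⟩ := cs.exists_isReduced w
      exact ⟨l.map cs.simple, by simpa using fun i _ ↦ cs.isReflection_simple i, rfl⟩
    obtain ⟨l, hl⟩ := h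
    exact ⟨_, l, rfl, hl⟩
  exact Nat.sInf_mem hne

theorem exists_isParabolic_of_absLe {x w : W} {l : List W} (hl : l ∈ RedT cs w)
    (htop : Subgroup.closure {t | t ∈ l} = ⊤) (hle : absLe cs x w) :
    ∃ l ∈ RedT cs x, IsParabolic cs (Subgroup.closure {t | t ∈ l}) := by
  obtain ⟨l₁, hl₁⟩ := exists_mem_redT (cs := cs) x
  obtain ⟨l₂, hl₂⟩ := exists_mem_redT (cs := cs) (x⁻¹ * w)
  have hmem : l₁ ++ l₂ ∈ RedT cs w := by
    refine ⟨?_, fun t ht ↦ (List.mem_append.1 ht).elim (hl₁.2.1 t) (hl₂.2.1 t), ?_⟩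
    · rw [List.length_append, hl₁.1, hl₂.1, hle]
    · rw [List.prod_append, hl₁.2.2, hl₂.2.2, mul_inv_cancel_left]
  have main {t : W} (ht : cs.IsReflection t)
      (h : cs.rootOf t ∈ listSpan (l₁.map cs.rootOf)) : t ∈ Subgroup.closure {t | t ∈ l₁} :=
    ht.mem_closure_of_mem_listSpan hl₁.2.1 hl₂.2.1 hl.2.1 htop ((cs.mem_redT_iff).1 hl).2.2
      ((cs.mem_redT_iff).1 hmem).2.2 (hmem.2.2.trans hl.2.2.symm) h
  refine ⟨l₁, hl₁, ?_⟩
  obtain ⟨g, J, h1, h2⟩ := cs.exists_parabolic_of_orthogonal (listSpan (l₁.map cs.rootOf))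
  refine ⟨g, J, le_antisymm ((Subgroup.closure_le _).2 fun t ht ↦ ?_) ?_⟩
  · refine ⟨g⁻¹ * t * g, h2 t fun v hv ↦ ?_, by simp [mul_assoc]⟩
    rw [(hl₁.2.1 t ht).geomRep_eq, M.refl_apply, hv _ (mem_listSpan (List.mem_map_of_mem ht)),
      zero_smul, sub_zero]
  · rw [MonoidHom.map_closure, Subgroup.closure_le]
    rintro _ ⟨_, ⟨j, hj, rfl⟩, rfl⟩
    have hr : cs.IsReflection (g * cs.simple j * g⁻¹) := ⟨g, j, rfl⟩
    refine main (t := g * cs.simple j * g⁻¹) hr ?_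
    have heq : M.refl (cs.rootOf (g * cs.simple j * g⁻¹)) =
        M.refl (cs.geomRep g (.single j 1)) := by
      rw [← hr.geomRep_eq, map_mul, map_mul, geomRep_simple, geomRep_conj_refl]
    rcases M.eq_or_eq_neg_of_refl_eq hr.isRoot_rootOf.cosForm_self
      ((isRoot_single j).geomRep g).cosForm_self heq with h | h <;> rw [h]
    · exact h1 j hj
    · exact neg_mem (h1 j hj)

end CoxeterSystem

/-- Let `(W, S)` be a finite (spherical) Coxeter system.  An element `x ∈ W` is a
parabolic quasi-Coxeter element (some reduced reflection factorization of `x` generates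
a parabolic subgroup) if and only if there is a quasi-Coxeter element `w` (some reduced
reflection factorization of `w` generates `W`) with `x ≤_T w` in the absolute order. -/
theorem parabolic_quasi_coxeter_iff_below_quasi_coxeter
    {B W : Type*} [Group W] [Finite W] {M : CoxeterMatrix B} (cs : CoxeterSystem M W)
    (x : W) :
    (∃ l ∈ RedT cs x, IsParabolic cs (Subgroup.closure {t | t ∈ l})) ↔
    ∃ w : W, (∃ l ∈ RedT cs w, Subgroup.closure {t | t ∈ l} = ⊤) ∧ absLe cs x w :=
  ⟨fun ⟨_, hl, hP⟩ ↦ cs.exists_quasiCoxeter_above hl hP,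
    fun ⟨_, ⟨_, hl, htop⟩, hle⟩ ↦ CoxeterSystem.exists_isParabolic_of_absLe hl htop hle⟩
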